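/- Let Γ be a Coxeter graph with vertex set S and let X ⊆ S. The natural group homomorphism VA[Γ_X] → VA[Γ] that maps σ_x to σ_x and τ_x to τ_x for every x ∈ X is injective, and its image is the standard parabolic subgroup VA_X[Γ]; hence it induces an isomorphism VA[Γ_X] ≅ VA_X[Γ]. -/

import Mathlib

/-- The alternating product `a b a b ⋯` of length `m`. -/
def altProd {G : Type*} [Monoid G] (a b : G) (m : ℕ) : G :=
  ((List.range m).map (fun i => if i % 2 = 0 then a else b)).prod

/-- The restriction of a Coxeter matrix to a subset of its index set (the Coxeter matrix of the
full Coxeter subgraph `Γ_X`). -/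
def CoxeterMatrix.restrict {S : Type*} (M : CoxeterMatrix S) (X : Set S) : CoxeterMatrix X where
  M := fun x y => M x y
  isSymm := Matrix.IsSymm.ext fun x y => M.isSymm.apply x y
  diagonal := fun x => M.diagonal x
  off_diagonal := fun x y hxy => M.off_diagonal x y (fun h => hxy (Subtype.ext h))

/-- The defining relations of the virtual Artin group of a Coxeter matrix `M`.
The generator `Sum.inl s` plays the role of `σ_s` and `Sum.inr s` plays the role of `τ_s`.
The value `M s t = 0` encodes `m_{s,t} = ∞`. -/
def vaRels {S : Type*} (M : CoxeterMatrix S) : Set (FreeGroup (S ⊕ S)) :=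
  {r | ∃ s t : S, s ≠ t ∧ M s t ≠ 0 ∧
      r = altProd (FreeGroup.of (Sum.inl s)) (FreeGroup.of (Sum.inl t)) (M s t) *
        (altProd (FreeGroup.of (Sum.inl t)) (FreeGroup.of (Sum.inl s)) (M s t))⁻¹} ∪
  {r | ∃ s : S, r = FreeGroup.of (Sum.inr s) * FreeGroup.of (Sum.inr s)} ∪
  {r | ∃ s t : S, s ≠ t ∧ M s t ≠ 0 ∧
      r = altProd (FreeGroup.of (Sum.inr s)) (FreeGroup.of (Sum.inr t)) (M s t) *
        (altProd (FreeGroup.of (Sum.inr t)) (FreeGroup.of (Sum.inr s)) (M s t))⁻¹} ∪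
  {r | ∃ s t : S, s ≠ t ∧ M s t ≠ 0 ∧
      r = FreeGroup.of (Sum.inl s) *
          altProd (FreeGroup.of (Sum.inr t)) (FreeGroup.of (Sum.inr s)) (M s t - 1) *
        (altProd (FreeGroup.of (Sum.inr t)) (FreeGroup.of (Sum.inr s)) (M s t - 1) *
          FreeGroup.of (Sum.inl (if Even (M s t) then s else t)))⁻¹}

/-- The virtual Artin group `VA[Γ]` of a Coxeter matrix. -/
def VirtualArtinGroup {S : Type*} (M : CoxeterMatrix S) : Type _ :=
  PresentedGroup (vaRels M)

instance {S : Type*} (M : CoxeterMatrix S) : Group (VirtualArtinGroup M) := by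
  unfold VirtualArtinGroup; infer_instance

/-- The generator `σ_s` of the virtual Artin group. -/
def VirtualArtinGroup.sigma {S : Type*} (M : CoxeterMatrix S) (s : S) : VirtualArtinGroup M :=
  PresentedGroup.of (Sum.inl s)

/-- The generator `τ_s` of the virtual Artin group. -/
def VirtualArtinGroup.tau {S : Type*} (M : CoxeterMatrix S) (s : S) : VirtualArtinGroup M :=
  PresentedGroup.of (Sum.inr s)

/-- The standard parabolic subgroup `VA_X[Γ]` of the virtual Artin group, generated by
`{σ_x | x ∈ X} ∪ {τ_x | x ∈ X}`. -/
def VirtualArtinGroup.parabolic {S : Type*} (M : CoxeterMatrix S) (X : Set S) :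
    Subgroup (VirtualArtinGroup M) :=
  Subgroup.closure ((fun s => VirtualArtinGroup.sigma M s) '' X ∪
    (fun s => VirtualArtinGroup.tau M s) '' X)


/-- Sine quotients `sin (k θ) / sin θ` as a function of `c = cos θ`, by their linear recursion. -/
noncomputable def sinQuot (c : ℝ) : ℕ → ℝ
  | 0 => 0
  | 1 => 1
  | (n + 2) => 2 * c * sinQuot c (n + 1) - sinQuot c n

theorem sinQuot_succ_succ (c : ℝ) (n : ℕ) :
    sinQuot c (n + 2) = 2 * c * sinQuot c (n + 1) - sinQuot c n := rfl

theorem sinQuot_mul_sin (θ : ℝ) (n : ℕ) :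
    sinQuot (Real.cos θ) n * Real.sin θ = Real.sin (n * θ) := by
  induction n using Nat.twoStepInduction with
  | zero => simp [sinQuot]
  | one => simp [sinQuot]
  | more n h0 h1 =>
    rw [sinQuot_succ_succ, sub_mul, mul_assoc, h0, h1]
    have e1 : ((n + 2 : ℕ) : ℝ) * θ = ((n + 1 : ℕ) : ℝ) * θ + θ := by push_cast; ring
    have e2 : (n : ℝ) * θ = ((n + 1 : ℕ) : ℝ) * θ - θ := by push_cast; ring
    rw [e1, e2, Real.sin_add, Real.sin_sub]
    ring

theorem sinQuot_one (n : ℕ) : sinQuot 1 n = n := by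
  induction n using Nat.twoStepInduction with
  | zero => simp [sinQuot]
  | one => simp [sinQuot]
  | more n h0 h1 => rw [sinQuot_succ_succ, h0, h1]; push_cast; ring

theorem sin_pi_div_pos {m : ℕ} (hm : 2 ≤ m) : 0 < Real.sin (Real.pi / m) := by
  have h2 : (2 : ℝ) ≤ m := by exact_mod_cast hm
  apply Real.sin_pos_of_pos_of_lt_pi
  · have := Real.pi_pos
    positivity
  · exact div_lt_self Real.pi_pos (by linarith)

theorem sinQuot_eq_div {m : ℕ} (hm : 2 ≤ m) (k : ℕ) :
    sinQuot (Real.cos (Real.pi / m)) k =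
      Real.sin (k * (Real.pi / m)) / Real.sin (Real.pi / m) := by
  rw [eq_div_iff (sin_pi_div_pos hm).ne', sinQuot_mul_sin]

theorem sinQuot_pos {m k : ℕ} (hm : m ≠ 1) (hk : 0 < k) (hkm : m = 0 ∨ k < m) :
    0 < sinQuot (Real.cos (Real.pi / m)) k := by
  rcases hkm with rfl | hkm
  · simp [sinQuot_one, hk]
  · have hm2 : 2 ≤ m := by omega
    rw [sinQuot_eq_div hm2]
    refine div_pos ?_ (sin_pi_div_pos hm2)
    have hm0 : (0 : ℝ) < m := by exact_mod_cast (by omega : 0 < m)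
    have hk0 : (0 : ℝ) < k := by exact_mod_cast hk
    have hkm' : (k : ℝ) < m := by exact_mod_cast hkm
    have := Real.pi_pos
    apply Real.sin_pos_of_pos_of_lt_pi
    · positivity
    · rw [← mul_div_assoc, div_lt_iff₀ hm0]
      nlinarith

theorem sinQuot_self {m : ℕ} (hm : 2 ≤ m) : sinQuot (Real.cos (Real.pi / m)) m = 0 := by
  have hm0 : (m : ℝ) ≠ 0 := by exact_mod_cast (by omega : m ≠ 0)
  rw [sinQuot_eq_div hm, mul_div_cancel₀ _ hm0, Real.sin_pi, zero_div]

theorem sinQuot_sub {m k : ℕ} (hm : 2 ≤ m) (hk : k ≤ m) :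
    sinQuot (Real.cos (Real.pi / m)) (m - k) = sinQuot (Real.cos (Real.pi / m)) k := by
  have hm0 : (m : ℝ) ≠ 0 := by exact_mod_cast (by omega : m ≠ 0)
  rw [sinQuot_eq_div hm, sinQuot_eq_div hm, Nat.cast_sub hk, sub_mul, mul_div_cancel₀ _ hm0,
    Real.sin_pi_sub]

theorem sinQuot_two_mul_self {m : ℕ} (hm : 2 ≤ m) :
    sinQuot (Real.cos (Real.pi / m)) (2 * m) = 0 := by
  have hm0 : (m : ℝ) ≠ 0 := by exact_mod_cast (by omega : m ≠ 0)
  rw [sinQuot_eq_div hm, Nat.cast_mul, mul_assoc, mul_div_cancel₀ _ hm0]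
  simp

theorem sinQuot_two_mul_self_add_one {m : ℕ} (hm : 2 ≤ m) :
    sinQuot (Real.cos (Real.pi / m)) (2 * m + 1) = 1 := by
  have hm0 : (m : ℝ) ≠ 0 := by exact_mod_cast (by omega : m ≠ 0)
  rw [sinQuot_eq_div hm, Nat.cast_add, Nat.cast_mul, add_mul, mul_assoc, mul_div_cancel₀ _ hm0]
  rw [div_eq_one_iff_eq (sin_pi_div_pos hm).ne']
  simp [add_comm _ (Real.pi / m), Real.sin_add_two_pi]

theorem sinQuot_cross {m k l : ℕ} (hm : 2 ≤ m) (hkl : k < l) (hl : l < m) :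
    sinQuot (Real.cos (Real.pi / m)) (k + 1) * sinQuot (Real.cos (Real.pi / m)) l -
      sinQuot (Real.cos (Real.pi / m)) k * sinQuot (Real.cos (Real.pi / m)) (l + 1) ≠ 0 := by
  have key : ∀ c : ℝ, ∀ k d : ℕ, sinQuot c (k + 1) * sinQuot c (k + d) -
      sinQuot c k * sinQuot c (k + d + 1) = sinQuot c d := by
    intro c k d
    induction k with
    | zero => simp [sinQuot]
    | succ k ih =>
      rw [← ih]
      have e1 : k + 1 + d = k + d + 1 := by ring
      rw [e1, sinQuot_succ_succ c k, sinQuot_succ_succ c (k + d)]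
      ring
  obtain ⟨d, rfl⟩ := Nat.exists_eq_add_of_lt hkl
  rw [add_assoc k d 1, key]
  exact (sinQuot_pos (by omega) (by omega) (by omega)).ne'

theorem pi_div_mem_Icc (m : ℕ) : Real.pi / m ∈ Set.Icc 0 Real.pi := by
  have := Real.pi_pos
  refine ⟨by positivity, ?_⟩
  rcases Nat.eq_zero_or_pos m with rfl | h
  · simp [this.le]
  · exact div_le_self this.le (by exact_mod_cast h)

theorem cos_pi_div_natCast_injective : Function.Injective fun m : ℕ => Real.cos (Real.pi / m) := by
  intro m n h
  have h1 := Real.injOn_cos (pi_div_mem_Icc m) (pi_div_mem_Icc n) h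
  have h2 : (m : ℝ)⁻¹ = (n : ℝ)⁻¹ := by
    rw [div_eq_mul_inv, div_eq_mul_inv] at h1
    exact mul_left_cancel₀ Real.pi_ne_zero h1
  exact_mod_cast inv_injective h2

section altProd

variable {G H : Type*}

theorem altProd_zero [Monoid G] (a b : G) : altProd a b 0 = 1 := by simp [altProd]

theorem altProd_succ [Monoid G] (a b : G) (k : ℕ) :
    altProd a b (k + 1) = altProd a b k * if k % 2 = 0 then a else b := by
  simp [altProd, List.range_succ]

theorem altProd_succ' [Monoid G] (a b : G) (k : ℕ) :
    altProd a b (k + 1) = a * altProd b a k := by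
  induction k with
  | zero => simp [altProd]
  | succ k ih =>
    rw [altProd_succ, ih, altProd_succ b a, mul_assoc]
    rcases Nat.mod_two_eq_zero_or_one k with h | h <;> simp [h, Nat.add_mod]

theorem map_altProd {F : Type*} [Monoid G] [Monoid H] [FunLike F G H] [MonoidHomClass F G H]
    (f : F) (a b : G) (k : ℕ) : f (altProd a b k) = altProd (f a) (f b) k := by
  induction k with
  | zero => simp [altProd_zero]
  | succ k ih => rw [altProd_succ, altProd_succ, map_mul, ih]; split_ifs <;> rfl

theorem altProd_mul_inv_altProd [Group G] {a b : G} (ha : a * a = 1) (hb : b * b = 1) (k : ℕ) :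
    altProd a b k * (altProd b a k)⁻¹ = (a * b) ^ k := by
  induction k generalizing a b with
  | zero => simp [altProd_zero]
  | succ k ih =>
    rw [altProd_succ', altProd_succ', mul_inv_rev, mul_assoc, ← mul_assoc _ _ b⁻¹, ih hb ha,
      inv_eq_of_mul_eq_one_left hb, ← mul_assoc, ← mul_pow_mul, pow_succ, mul_assoc]

theorem altProd_comm_iff [Group G] {a b : G} (ha : a * a = 1) (hb : b * b = 1) (k : ℕ) :
    altProd a b k = altProd b a k ↔ (a * b) ^ k = 1 := by
  rw [← altProd_mul_inv_altProd ha hb, mul_inv_eq_one]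

end altProd
namespace CoxeterMatrix

variable {B : Type*} (M : CoxeterMatrix B)

/-- The cosine `cos (π / m_{s,t})`, which is `1` when `m_{s,t} = ∞`. -/
noncomputable def cosAngle (s t : B) : ℝ := Real.cos (Real.pi / M s t)

/-- The simple root `α_s`. -/
noncomputable abbrev simpleRoot (s : B) : B →₀ ℝ := Finsupp.single s 1

/-- The pairing `v ↦ ⟨α_s, v⟩` for the canonical bilinear form of a Coxeter matrix. -/
noncomputable def pairing (s : B) : (B →₀ ℝ) →ₗ[ℝ] ℝ :=
  Finsupp.linearCombination ℝ fun t => -M.cosAngle s t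

/-- The canonical bilinear form of a Coxeter matrix. -/
noncomputable def form : (B →₀ ℝ) →ₗ[ℝ] (B →₀ ℝ) →ₗ[ℝ] ℝ :=
  Finsupp.linearCombination ℝ M.pairing

/-- The reflection in the simple root `α_s`. -/
noncomputable def simpleReflection (s : B) : Module.End ℝ (B →₀ ℝ) :=
  1 - (2 : ℝ) • (M.pairing s).smulRight (simpleRoot s)

theorem cosAngle_comm (s t : B) : M.cosAngle s t = M.cosAngle t s := by
  rw [cosAngle, cosAngle, M.symmetric]

theorem cosAngle_self (s : B) : M.cosAngle s s = -1 := by simp [cosAngle]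

theorem pairing_simpleRoot (s t : B) : M.pairing s (simpleRoot t) = -M.cosAngle s t := by
  simp [pairing]

theorem form_simpleRoot (s : B) : M.form (simpleRoot s) = M.pairing s := by
  simp [form]

theorem form_simpleRoot_right (v : B →₀ ℝ) (s : B) :
    M.form v (simpleRoot s) = M.pairing s v := by
  induction v using Finsupp.induction_linear with
  | zero => simp
  | add u v hu hv => rw [map_add, LinearMap.add_apply, hu, hv, map_add]
  | single t c =>
    have : Finsupp.single t c = c • simpleRoot t := by simp
    rw [this, map_smul, LinearMap.smul_apply, form_simpleRoot, map_smul, pairing_simpleRoot,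
      pairing_simpleRoot, cosAngle_comm]

theorem simpleReflection_apply (s : B) (v : B →₀ ℝ) :
    M.simpleReflection s v = v - (2 * M.pairing s v) • simpleRoot s := by
  simp only [simpleReflection, LinearMap.sub_apply, LinearMap.smul_apply,
    LinearMap.smulRight_apply, Module.End.one_apply, smul_smul]

theorem simpleReflection_self (s : B) :
    M.simpleReflection s (simpleRoot s) = -simpleRoot s := by
  rw [simpleReflection_apply, pairing_simpleRoot, cosAngle_self]
  module

theorem simpleReflection_simpleRoot (s t : B) :
    M.simpleReflection s (simpleRoot t) = simpleRoot t + (2 * M.cosAngle s t) • simpleRoot s := by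
  rw [simpleReflection_apply, pairing_simpleRoot]
  module

theorem simpleReflection_mul_self (s : B) : M.simpleReflection s * M.simpleReflection s = 1 := by
  refine LinearMap.ext fun v => ?_
  rw [Module.End.mul_apply, simpleReflection_apply M s v, map_sub, map_smul,
    simpleReflection_self, simpleReflection_apply, Module.End.one_apply]
  module

theorem form_simpleReflection (s : B) (u v : B →₀ ℝ) :
    M.form (M.simpleReflection s u) (M.simpleReflection s v) = M.form u v := by
  simp only [simpleReflection_apply, map_sub, map_smul, LinearMap.sub_apply, LinearMap.smul_apply,
    form_simpleRoot, form_simpleRoot_right, pairing_simpleRoot, cosAngle_self, smul_eq_mul]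
  ring

theorem simpleReflection_mul_pow_left (s t : B) (n : ℕ) :
    ((M.simpleReflection s * M.simpleReflection t) ^ n) (simpleRoot s) =
      sinQuot (M.cosAngle s t) (2 * n + 1) • simpleRoot s +
        sinQuot (M.cosAngle s t) (2 * n) • simpleRoot t := by
  induction n with
  | zero => simp [sinQuot]
  | succ n ih =>
    rw [pow_succ', Module.End.mul_apply, ih, Module.End.mul_apply]
    simp only [map_add, map_smul, simpleReflection_self, simpleReflection_simpleRoot, map_neg]
    have e : 2 * (n + 1) = 2 * n + 2 := by ring
    have e' : 2 * n + 2 + 1 = (2 * n + 1) + 2 := by ring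
    rw [e, e', sinQuot_succ_succ _ (2 * n + 1), sinQuot_succ_succ _ (2 * n), M.cosAngle_comm t s]
    module

theorem simpleReflection_mul_pow_right (s t : B) (n : ℕ) :
    ((M.simpleReflection s * M.simpleReflection t) ^ n) (simpleRoot t) =
      -(sinQuot (M.cosAngle s t) (2 * n) • simpleRoot s) +
        (sinQuot (M.cosAngle s t) (2 * n + 1) -
          2 * M.cosAngle s t * sinQuot (M.cosAngle s t) (2 * n)) • simpleRoot t := by
  induction n with
  | zero => simp [sinQuot]
  | succ n ih =>
    rw [pow_succ', Module.End.mul_apply, ih, Module.End.mul_apply]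
    simp only [map_add, map_smul, simpleReflection_self, simpleReflection_simpleRoot, map_neg]
    have e : 2 * (n + 1) = 2 * n + 2 := by ring
    have e' : 2 * n + 2 + 1 = (2 * n + 1) + 2 := by ring
    rw [e, e', sinQuot_succ_succ _ (2 * n + 1), sinQuot_succ_succ _ (2 * n), M.cosAngle_comm t s]
    module

theorem two_le_of_ne {s t : B} (hst : s ≠ t) (h0 : M s t ≠ 0) : 2 ≤ M s t := by
  have := M.off_diagonal s t hst
  omega

theorem cosAngle_sq_ne_one {s t : B} (hst : s ≠ t) (h0 : M s t ≠ 0) :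
    1 - M.cosAngle s t ^ 2 ≠ 0 := by
  have h := sin_pi_div_pos (M.two_le_of_ne hst h0)
  rw [cosAngle, ← Real.sin_sq]
  positivity

theorem isLiftable_simpleReflection : M.IsLiftable M.simpleReflection := by
  intro s t
  by_cases hst : s = t
  · subst hst
    rw [M.diagonal, pow_one, simpleReflection_mul_self]
  by_cases h0 : M s t = 0
  · rw [h0, pow_zero]
  have hm := M.two_le_of_ne hst h0
  have hfix : ∀ v, M.pairing s v = 0 → M.pairing t v = 0 → ∀ n : ℕ,
      ((M.simpleReflection s * M.simpleReflection t) ^ n) v = v := by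
    intro v hs ht n
    induction n with
    | zero => simp
    | succ n ih =>
      rw [pow_succ', Module.End.mul_apply, ih, Module.End.mul_apply, simpleReflection_apply M t,
        ht, mul_zero, zero_smul, sub_zero, simpleReflection_apply, hs, mul_zero, zero_smul,
        sub_zero]
  refine LinearMap.ext fun v => ?_
  have hd := M.cosAngle_sq_ne_one hst h0
  set c := M.cosAngle s t with hc
  obtain ⟨p, hp⟩ : ∃ p, p = (M.pairing s v + c * M.pairing t v) / (1 - c ^ 2) := ⟨_, rfl⟩
  obtain ⟨q, hq⟩ : ∃ q, q = (M.pairing t v + c * M.pairing s v) / (1 - c ^ 2) := ⟨_, rfl⟩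
  obtain ⟨v₀, hv₀⟩ : ∃ v₀, v₀ = v - p • simpleRoot s - q • simpleRoot t := ⟨_, rfl⟩
  have hv : v = v₀ + p • simpleRoot s + q • simpleRoot t := by rw [hv₀]; module
  have h1 : M.pairing s v₀ = 0 := by
    simp only [hv₀, map_sub, map_smul, pairing_simpleRoot, cosAngle_self, smul_eq_mul, ← hc]
    rw [hp, hq]
    field_simp
    ring
  have h2 : M.pairing t v₀ = 0 := by
    simp only [hv₀, map_sub, map_smul, pairing_simpleRoot, cosAngle_self, smul_eq_mul,
      M.cosAngle_comm t s, ← hc]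
    rw [hp, hq]
    field_simp
    ring
  rw [hv, map_add, map_add, map_smul, map_smul, hfix _ h1 h2, simpleReflection_mul_pow_left,
    simpleReflection_mul_pow_right, cosAngle, sinQuot_two_mul_self hm,
    sinQuot_two_mul_self_add_one hm]
  simp

/-- The geometric representation of a Coxeter group. -/
noncomputable def rep : M.Group →* Module.End ℝ (B →₀ ℝ) :=
  M.toCoxeterSystem.lift ⟨M.simpleReflection, M.isLiftable_simpleReflection⟩

theorem rep_simple (s : B) : M.rep (M.simple s) = M.simpleReflection s := by
  rw [rep, ← M.toCoxeterSystem_simple, CoxeterSystem.lift_apply_simple]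

theorem rep_inv_apply (w : M.Group) (v : B →₀ ℝ) : M.rep w⁻¹ (M.rep w v) = v := by
  rw [← Module.End.mul_apply, ← map_mul, inv_mul_cancel, map_one, Module.End.one_apply]

theorem rep_apply_inv (w : M.Group) (v : B →₀ ℝ) : M.rep w (M.rep w⁻¹ v) = v := by
  rw [← Module.End.mul_apply, ← map_mul, mul_inv_cancel, map_one, Module.End.one_apply]

theorem rep_injective (w : M.Group) : Function.Injective (M.rep w) :=
  Function.LeftInverse.injective (M.rep_inv_apply w)

theorem form_rep (w : M.Group) (u v : B →₀ ℝ) : M.form (M.rep w u) (M.rep w v) = M.form u v := by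
  induction w using M.toCoxeterSystem.simple_induction_left with
  | one => simp
  | mul_simple_left w s ih =>
    rw [map_mul, Module.End.mul_apply, Module.End.mul_apply, M.toCoxeterSystem_simple, rep_simple,
      form_simpleReflection, ih]

theorem simple_mul_self (s : B) : M.simple s * M.simple s = 1 := by
  simpa using M.toCoxeterSystem.simple_mul_simple_self s

theorem altProd_simple_comm {s t : B} :
    altProd (M.simple s) (M.simple t) (M s t) = altProd (M.simple t) (M.simple s) (M s t) := by
  rw [altProd_comm_iff (M.simple_mul_self s) (M.simple_mul_self t)]
  simpa using M.toCoxeterSystem.simple_mul_simple_pow s t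

theorem rep_inv_altProd (s t : B) (k : ℕ) :
    M.rep (altProd (M.simple t) (M.simple s) k)⁻¹ (simpleRoot s) =
      sinQuot (M.cosAngle s t) (k + 1) • simpleRoot (if k % 2 = 0 then s else t) +
        sinQuot (M.cosAngle s t) k • simpleRoot (if k % 2 = 0 then t else s) := by
  induction k with
  | zero => simp [sinQuot, altProd_zero]
  | succ k ih =>
    rw [altProd_succ, mul_inv_rev, map_mul, Module.End.mul_apply, ih, sinQuot_succ_succ]
    rcases Nat.mod_two_eq_zero_or_one k with h | h
    · have h' : (k + 1) % 2 ≠ 0 := by omega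
      simp only [h, h', if_true, if_false, inv_eq_of_mul_eq_one_left (M.simple_mul_self _),
        rep_simple, map_add, map_smul, simpleReflection_self, simpleReflection_simpleRoot,
        M.cosAngle_comm t s]
      module
    · have h' : (k + 1) % 2 = 0 := by omega
      simp only [h, h', one_ne_zero, if_true, if_false,
        inv_eq_of_mul_eq_one_left (M.simple_mul_self _),
        rep_simple, map_add, map_smul, simpleReflection_self, simpleReflection_simpleRoot]
      module

theorem rep_altProd (s t : B) (k : ℕ) :
    M.rep (altProd (M.simple s) (M.simple t) k) (simpleRoot (if k % 2 = 0 then s else t)) =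
      sinQuot (M.cosAngle s t) (k + 1) • simpleRoot s +
        sinQuot (M.cosAngle s t) k • simpleRoot t := by
  induction k generalizing s t with
  | zero => simp [sinQuot, altProd_zero]
  | succ k ih =>
    have h : (if (k + 1) % 2 = 0 then s else t) = if k % 2 = 0 then t else s := by
      rcases Nat.mod_two_eq_zero_or_one k with h | h <;> simp [h, Nat.add_mod]
    rw [altProd_succ', map_mul, Module.End.mul_apply, h, ih, sinQuot_succ_succ, rep_simple]
    simp only [map_add, map_smul, simpleReflection_self, simpleReflection_simpleRoot,
      M.cosAngle_comm t s]
    module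

theorem length_altProd_le (s t : B) (k : ℕ) :
    M.toCoxeterSystem.length (altProd (M.simple s) (M.simple t) k) ≤ k := by
  induction k generalizing s t with
  | zero => simp [altProd_zero]
  | succ k ih =>
    rw [altProd_succ']
    have h1 := M.toCoxeterSystem.length_mul_le (M.simple s) (altProd (M.simple t) (M.simple s) k)
    have h2 := M.toCoxeterSystem.length_simple s
    rw [toCoxeterSystem_simple] at h2
    have := ih t s
    omega

theorem length_mul_simple_cases (w : M.Group) (s : B) :
    M.toCoxeterSystem.length (w * M.simple s) = M.toCoxeterSystem.length w + 1 ∨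
      M.toCoxeterSystem.length (w * M.simple s) + 1 = M.toCoxeterSystem.length w := by
  simpa using M.toCoxeterSystem.length_mul_simple w s

/-- Peeling off from the right of `w` the longest possible alternating word in `s` and `t`. -/
theorem exists_dihedral_factor (w : M.Group) {s t : B}
    (hs : M.toCoxeterSystem.length w < M.toCoxeterSystem.length (w * M.simple s))
    (ht : M.toCoxeterSystem.length (w * M.simple t) < M.toCoxeterSystem.length w) :
    ∃ (k : ℕ) (v : M.Group), 0 < k ∧ v = w * altProd (M.simple t) (M.simple s) k ∧
      M.toCoxeterSystem.length v + k = M.toCoxeterSystem.length w ∧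
      M.toCoxeterSystem.length v < M.toCoxeterSystem.length (v * M.simple s) ∧
      M.toCoxeterSystem.length v < M.toCoxeterSystem.length (v * M.simple t) ∧
      (M s t = 0 ∨ k < M s t) := by
  classical
  let P : ℕ → Prop := fun k =>
    M.toCoxeterSystem.length (w * altProd (M.simple t) (M.simple s) k) + k =
      M.toCoxeterSystem.length w
  have hlow : ∀ k, M.toCoxeterSystem.length w ≤
      M.toCoxeterSystem.length (w * altProd (M.simple t) (M.simple s) k) + k :=
    fun k => (M.toCoxeterSystem.length_le_length_mul_add_right w _).trans
      (Nat.add_le_add_left (M.length_altProd_le t s k) _)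
  have hstep : ∀ k, w * altProd (M.simple t) (M.simple s) (k + 1) =
      w * altProd (M.simple t) (M.simple s) k * M.simple (if k % 2 = 0 then t else s) := by
    intro k
    rw [altProd_succ, mul_assoc]
    split_ifs <;> rfl
  have hP1 : P 1 := by
    have := M.length_mul_simple_cases w t
    have e : altProd (M.simple t) (M.simple s) 1 = M.simple t := by simp [altProd]
    simp only [P, e]
    omega
  have hpos : 1 ≤ M.toCoxeterSystem.length w := by omega
  obtain ⟨k, hk⟩ : ∃ k, k = Nat.findGreatest P (M.toCoxeterSystem.length w) := ⟨_, rfl⟩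
  have hPk : P k := hk ▸ Nat.findGreatest_spec hpos hP1
  have hk1 : 1 ≤ k := hk ▸ Nat.le_findGreatest hpos hP1
  have hPs : ¬ P (k + 1) := fun h => by
    have hle : k + 1 ≤ M.toCoxeterSystem.length w := by simp only [P] at h; omega
    have := Nat.le_findGreatest hle h
    omega
  have hnext : M.toCoxeterSystem.length (w * altProd (M.simple t) (M.simple s) k) <
      M.toCoxeterSystem.length (w * altProd (M.simple t) (M.simple s) k *
        M.simple (if k % 2 = 0 then t else s)) := by
    have := M.length_mul_simple_cases (w * altProd (M.simple t) (M.simple s) k)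
      (if k % 2 = 0 then t else s)
    simp only [P, hstep] at hPs hPk
    omega
  have hlast : M.toCoxeterSystem.length (w * altProd (M.simple t) (M.simple s) k) <
      M.toCoxeterSystem.length (w * altProd (M.simple t) (M.simple s) k *
        M.simple (if k % 2 = 0 then s else t)) := by
    obtain ⟨j, rfl⟩ : ∃ j, k = j + 1 := ⟨k - 1, by omega⟩
    have e : (if (j + 1) % 2 = 0 then s else t) = if j % 2 = 0 then t else s := by
      rcases Nat.mod_two_eq_zero_or_one j with h | h <;> simp [h, Nat.add_mod]
    rw [e, hstep, mul_assoc _ (M.simple _) (M.simple _), simple_mul_self, mul_one, ← hstep]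
    have := hlow j
    simp only [P] at hPk
    omega
  refine ⟨k, _, hk1, rfl, hPk, ?_, ?_, ?_⟩
  · rcases Nat.mod_two_eq_zero_or_one k with h | h
    · simpa [h] using hlast
    · simpa [h] using hnext
  · rcases Nat.mod_two_eq_zero_or_one k with h | h
    · simpa [h] using hnext
    · simpa [h] using hlast
  · by_contra! hcon
    obtain ⟨h0, hmk⟩ := hcon
    have hdown : ∀ d, d ≤ k → P (k - d) := by
      intro d
      induction d with
      | zero => intro _; exact hPk
      | succ d ih =>
        intro hd
        have h1 := ih (by omega)
        obtain ⟨j, hj⟩ : ∃ j, k - d = j + 1 := ⟨k - d - 1, by omega⟩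
        have hj' : k - (d + 1) = j := by omega
        rw [hj] at h1
        rw [hj']
        simp only [P, hstep] at h1 ⊢
        have := hlow j
        have := M.length_mul_simple_cases (w * altProd (M.simple t) (M.simple s) j)
          (if j % 2 = 0 then t else s)
        omega
    have hPm : P (M s t) := by
      have := hdown (k - M s t) (by omega)
      rwa [Nat.sub_sub_self hmk] at this
    obtain ⟨j, hj⟩ : ∃ j, M s t = j + 1 := ⟨M s t - 1, by omega⟩
    simp only [P] at hPm
    rw [← altProd_simple_comm, hj, altProd_succ', ← mul_assoc] at hPm
    have h1 := M.toCoxeterSystem.length_le_length_mul_add_right (w * M.simple s)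
      (altProd (M.simple t) (M.simple s) j)
    have h2 := M.length_altProd_le t s j
    omega

theorem sinQuot_cosAngle_pos {s t : B} (hst : s ≠ t) {k : ℕ} (hk : 0 < k)
    (h : M s t = 0 ∨ k < M s t) : 0 < sinQuot (M.cosAngle s t) k :=
  sinQuot_pos (M.off_diagonal s t hst) hk h

theorem sinQuot_cosAngle_nonneg {s t : B} (hst : s ≠ t) {k : ℕ}
    (h : M s t = 0 ∨ k ≤ M s t) : 0 ≤ sinQuot (M.cosAngle s t) k := by
  rcases Nat.eq_zero_or_pos k with rfl | hk
  · exact le_rfl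
  by_cases h' : M s t = 0 ∨ k < M s t
  · exact (M.sinQuot_cosAngle_pos hst hk h').le
  · have : k = M s t := by omega
    rw [this, cosAngle, sinQuot_self (M.two_le_of_ne hst (by omega))]

theorem simpleRoot_nonneg (s : B) : 0 ≤ simpleRoot s := by
  intro t
  classical
  rw [Finsupp.single_apply]
  split_ifs <;> simp

theorem rep_simpleRoot_nonneg {w : M.Group} {s : B}
    (h : M.toCoxeterSystem.length w < M.toCoxeterSystem.length (w * M.simple s)) :
    0 ≤ M.rep w (simpleRoot s) := by
  obtain ⟨n, hn⟩ : ∃ n, M.toCoxeterSystem.length w = n := ⟨_, rfl⟩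
  induction n using Nat.strong_induction_on generalizing w s with
  | _ n ih =>
  by_cases hw : w = 1
  · rw [hw, map_one]
    exact simpleRoot_nonneg s
  obtain ⟨t, ht⟩ := M.toCoxeterSystem.exists_rightDescent_of_ne_one hw
  rw [CoxeterSystem.IsRightDescent, toCoxeterSystem_simple] at ht
  have hst : s ≠ t := by rintro rfl; omega
  obtain ⟨k, v, hk, hv, hlen, hvs, hvt, hkm⟩ := M.exists_dihedral_factor w h ht
  have hw : w = v * (altProd (M.simple t) (M.simple s) k)⁻¹ := by rw [hv, mul_inv_cancel_right]
  have ps := ih _ (by omega) hvs rfl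
  have pt := ih _ (by omega) hvt rfl
  rw [hw, map_mul, Module.End.mul_apply, rep_inv_altProd, map_add, map_smul, map_smul]
  have h1 := M.sinQuot_cosAngle_nonneg hst (k := k + 1) (by omega)
  have h2 := M.sinQuot_cosAngle_nonneg hst (k := k) (by omega)
  refine add_nonneg (smul_nonneg h1 ?_) (smul_nonneg h2 ?_) <;> split_ifs <;> assumption

theorem rep_simpleRoot_nonpos {w : M.Group} {s : B}
    (h : M.toCoxeterSystem.length (w * M.simple s) < M.toCoxeterSystem.length w) :
    M.rep w (simpleRoot s) ≤ 0 := by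
  have h1 : 0 ≤ M.rep (w * M.simple s) (simpleRoot s) :=
    M.rep_simpleRoot_nonneg (by rwa [mul_assoc, simple_mul_self, mul_one])
  rw [map_mul, Module.End.mul_apply, rep_simple, simpleReflection_self, map_neg] at h1
  exact neg_nonneg.mp h1

theorem rep_simpleRoot_nonneg_or_nonpos (w : M.Group) (s : B) :
    0 ≤ M.rep w (simpleRoot s) ∨ M.rep w (simpleRoot s) ≤ 0 := by
  rcases M.length_mul_simple_cases w s with h | h
  · exact .inl (M.rep_simpleRoot_nonneg (by omega))
  · exact .inr (M.rep_simpleRoot_nonpos (by omega))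

theorem rep_simpleRoot_ne_zero (w : M.Group) (s : B) : M.rep w (simpleRoot s) ≠ 0 := fun h => by
  have h1 := M.form_rep w (simpleRoot s) (simpleRoot s)
  rw [h, map_zero, form_simpleRoot, pairing_simpleRoot, cosAngle_self] at h1
  norm_num at h1

theorem not_simpleRoot_nonpos (s : B) : ¬ simpleRoot s ≤ 0 := fun h => by
  have := h s
  simp at this
  linarith

theorem length_lt_of_rep_nonneg {w : M.Group} {s : B} (h : 0 ≤ M.rep w (simpleRoot s)) :
    M.toCoxeterSystem.length w < M.toCoxeterSystem.length (w * M.simple s) := by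
  rcases M.length_mul_simple_cases w s with h' | h'
  · omega
  · exact absurd (le_antisymm (M.rep_simpleRoot_nonpos (by omega)) h)
      (M.rep_simpleRoot_ne_zero w s)

theorem eq_smul_simpleRoot {v : B →₀ ℝ} {s : B} (h : ∀ t, t ≠ s → v t = 0) :
    v = v s • simpleRoot s := by
  ext t
  by_cases ht : t = s
  · subst ht; simp
  · rw [h t ht]; simp [Ne.symm ht]

theorem rep_eq_simpleRoot {w : M.Group} {s t : B} (h0 : 0 ≤ M.rep w (simpleRoot s))
    (h : ∀ r, r ≠ t → M.rep w (simpleRoot s) r = 0) :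
    M.rep w (simpleRoot s) = simpleRoot t := by
  have h1 := M.form_rep w (simpleRoot s) (simpleRoot s)
  have h2 : 0 ≤ M.rep w (simpleRoot s) t := h0 t
  have h3 := eq_smul_simpleRoot h
  obtain ⟨c, hc⟩ : ∃ c, c = M.rep w (simpleRoot s) t := ⟨_, rfl⟩
  rw [← hc] at h2 h3
  rw [h3] at h1 ⊢
  simp only [map_smul, LinearMap.smul_apply, form_simpleRoot, pairing_simpleRoot, cosAngle_self,
    smul_eq_mul] at h1
  have : c = 1 := by nlinarith
  rw [this, one_smul]

theorem eq_one_of_rep_eq {w : M.Group} (h : ∀ s, M.rep w (simpleRoot s) = simpleRoot s) :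
    w = 1 := by
  by_contra hw
  obtain ⟨t, ht⟩ := M.toCoxeterSystem.exists_rightDescent_of_ne_one hw
  rw [CoxeterSystem.IsRightDescent, toCoxeterSystem_simple] at ht
  have := M.rep_simpleRoot_nonpos ht
  rw [h] at this
  exact not_simpleRoot_nonpos t this

theorem conj_simple {w : M.Group} {s t : B} (h : M.rep w (simpleRoot s) = simpleRoot t) :
    w * M.simple s = M.simple t * w := by
  have key : ∀ v, M.rep (w * M.simple s) v = M.rep (M.simple t * w) v := by
    intro v
    rw [map_mul, map_mul, Module.End.mul_apply, Module.End.mul_apply, rep_simple, rep_simple,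
      simpleReflection_apply, simpleReflection_apply, map_sub, map_smul, h, ← form_simpleRoot,
      ← form_simpleRoot, ← h, form_rep]
  rw [← inv_mul_eq_one]
  refine M.eq_one_of_rep_eq fun r => ?_
  rw [map_mul, Module.End.mul_apply, ← key, rep_inv_apply]

section Parabolic

variable {B' : Type*} (j : B' → B)

/-- `w` is of minimal length in its left coset `W_X w`, where `X` is the range of `j`. -/
def IsMinimalRep (w : M.Group) : Prop := ∀ x, 0 ≤ M.rep w⁻¹ (simpleRoot (j x))

/-- The span of the simple roots indexed by the range of `j`. -/
noncomputable def parabolicSpan (j : B' → B) : Submodule ℝ (B →₀ ℝ) :=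
  Finsupp.supported ℝ ℝ (Set.range j)

theorem simpleRoot_mem_parabolicSpan (x : B') : simpleRoot (j x) ∈ parabolicSpan j :=
  Finsupp.single_mem_supported ℝ _ ⟨x, rfl⟩

theorem isMinimalRep_one : M.IsMinimalRep j 1 := fun x => by
  rw [inv_one, map_one]
  exact simpleRoot_nonneg _

variable {M j}

theorem IsMinimalRep.exists_eq_simpleRoot {w : M.Group} (hw : M.IsMinimalRep j w) {s : B}
    (h : M.rep w (simpleRoot s) ∈ parabolicSpan j) :
    ∃ x, M.rep w (simpleRoot s) = simpleRoot (j x) := by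
  classical
  obtain ⟨v, hv⟩ : ∃ v, v = M.rep w (simpleRoot s) := ⟨_, rfl⟩
  have hsum : simpleRoot s = ∑ b ∈ v.support, v b • M.rep w⁻¹ (simpleRoot b) := by
    have h1 : v = ∑ b ∈ v.support, v b • simpleRoot b := by
      conv_lhs => rw [← Finsupp.sum_single v]
      simp [Finsupp.sum]
    rw [← M.rep_inv_apply w (simpleRoot s), ← hv]
    conv_lhs => rw [h1]
    simp only [map_sum, map_smul]
  rw [← hv] at h ⊢
  have hmem : ∀ b ∈ v.support, 0 ≤ M.rep w⁻¹ (simpleRoot b) := by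
    intro b hb
    obtain ⟨x, rfl⟩ := (Finsupp.mem_supported ℝ v).1 h hb
    exact hw x
  rcases M.rep_simpleRoot_nonneg_or_nonpos w s with h0 | h0
  · rw [← hv] at h0
    obtain ⟨b, hb⟩ := Finsupp.support_nonempty_iff.2 (hv ▸ M.rep_simpleRoot_ne_zero w s)
    obtain ⟨x, rfl⟩ := (Finsupp.mem_supported ℝ v).1 h hb
    refine ⟨x, ?_⟩
    have hpos : 0 < v (j x) := lt_of_le_of_ne (h0 _) (Ne.symm (Finsupp.mem_support_iff.1 hb))
    have hle : v (j x) • M.rep w⁻¹ (simpleRoot (j x)) ≤ simpleRoot s := by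
      rw [hsum]
      exact Finset.single_le_sum (f := fun b => v b • M.rep w⁻¹ (simpleRoot b))
        (fun b hb => smul_nonneg (h0 b) (hmem b hb)) hb
    have heq : M.rep w⁻¹ (simpleRoot (j x)) = simpleRoot s := by
      refine M.rep_eq_simpleRoot (hw x) fun r hr => ?_
      have h1 := hle r
      have h2 : 0 ≤ M.rep w⁻¹ (simpleRoot (j x)) r := hw x r
      rw [Finsupp.single_eq_of_ne hr, Finsupp.smul_apply, smul_eq_mul] at h1
      nlinarith
    rw [hv, ← heq, rep_apply_inv]
  · rw [← hv] at h0
    exfalso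
    refine not_simpleRoot_nonpos s ?_
    rw [hsum]
    exact Finset.sum_nonpos fun b hb =>
      smul_nonpos_of_nonpos_of_nonneg (h0 b) (hmem b hb)

theorem IsMinimalRep.mul_simple {w : M.Group} (hw : M.IsMinimalRep j w) {s : B}
    (h : ¬ ∃ x, M.rep w (simpleRoot s) = simpleRoot (j x)) :
    M.IsMinimalRep j (w * M.simple s) := by
  intro x
  rcases M.rep_simpleRoot_nonneg_or_nonpos (w * M.simple s)⁻¹ (j x) with h0 | h0
  · exact h0
  · exfalso
    refine h ⟨x, ?_⟩
    rw [mul_inv_rev, inv_eq_of_mul_eq_one_left (M.simple_mul_self s), map_mul,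
      Module.End.mul_apply, rep_simple, simpleReflection_apply] at h0
    have heq : M.rep w⁻¹ (simpleRoot (j x)) = simpleRoot s := by
      refine M.rep_eq_simpleRoot (hw x) fun r hr => le_antisymm ?_ (hw x r)
      have := h0 r
      rw [Finsupp.sub_apply, Finsupp.smul_apply, Finsupp.single_eq_of_ne hr, smul_zero,
        sub_zero] at this
      exact this
    rw [← heq, rep_apply_inv]

theorem simpleReflection_mem_parabolicSpan (x : B') {v : B →₀ ℝ} (hv : v ∈ parabolicSpan j) :
    M.simpleReflection (j x) v ∈ parabolicSpan j := by
  rw [simpleReflection_apply]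
  exact Submodule.sub_mem _ hv (Submodule.smul_mem _ _ (simpleRoot_mem_parabolicSpan j x))

variable (M j)

theorem exists_mul_isMinimalRep (w : M.Group) :
    ∃ u ∈ Subgroup.closure (Set.range fun x => M.simple (j x)), ∃ v, M.IsMinimalRep j v ∧
      w = u * v := by
  obtain ⟨n, hn⟩ : ∃ n, M.toCoxeterSystem.length w = n := ⟨_, rfl⟩
  induction n using Nat.strong_induction_on generalizing w with
  | _ n ih =>
  by_cases hw : M.IsMinimalRep j w
  · exact ⟨1, one_mem _, w, hw, (one_mul w).symm⟩
  · obtain ⟨x, hx⟩ := not_forall.1 hw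
    have hlt : M.toCoxeterSystem.length (M.simple (j x) * w) < n := by
      rw [← hn, ← CoxeterSystem.length_inv, ← M.toCoxeterSystem.length_inv w, mul_inv_rev,
        inv_eq_of_mul_eq_one_left (M.simple_mul_self _)]
      rcases M.length_mul_simple_cases w⁻¹ (j x) with h | h
      · exact absurd (M.rep_simpleRoot_nonneg (by omega)) hx
      · omega
    obtain ⟨u, hu, v, hv, huv⟩ := ih _ hlt _ rfl
    refine ⟨M.simple (j x) * u, mul_mem (Subgroup.subset_closure ⟨x, rfl⟩) hu, v, hv, ?_⟩
    rw [mul_assoc, ← huv, ← mul_assoc, simple_mul_self, one_mul]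

end Parabolic

theorem apply_eq_of_rep_eq {w : M.Group} {s t a b : B}
    (hs : M.rep w (simpleRoot s) = simpleRoot a) (ht : M.rep w (simpleRoot t) = simpleRoot b) :
    M s t = M a b := by
  have h := M.form_rep w (simpleRoot s) (simpleRoot t)
  rw [hs, ht, form_simpleRoot, form_simpleRoot, pairing_simpleRoot, pairing_simpleRoot,
    neg_inj] at h
  exact (cos_pi_div_natCast_injective h).symm

theorem simpleRoot_injective : Function.Injective (simpleRoot : B → B →₀ ℝ) :=
  Finsupp.single_left_injective one_ne_zero

/-- The Artin group of a Coxeter matrix. -/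
def ArtinGroup : Type _ :=
  PresentedGroup {r : FreeGroup B | ∃ s t, s ≠ t ∧ M s t ≠ 0 ∧
    r = altProd (FreeGroup.of s) (FreeGroup.of t) (M s t) *
      (altProd (FreeGroup.of t) (FreeGroup.of s) (M s t))⁻¹}

instance : Group M.ArtinGroup := by
  unfold ArtinGroup; infer_instance

namespace ArtinGroup

/-- The standard generators of an Artin group. -/
def of (s : B) : M.ArtinGroup := PresentedGroup.of s

theorem altProd_of_comm {s t : B} (hst : s ≠ t) (h0 : M s t ≠ 0) :
    altProd (of M s) (of M t) (M s t) = altProd (of M t) (of M s) (M s t) := by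
  have h := PresentedGroup.one_of_mem (rels := {r : FreeGroup B | ∃ s t, s ≠ t ∧ M s t ≠ 0 ∧
    r = altProd (FreeGroup.of s) (FreeGroup.of t) (M s t) *
      (altProd (FreeGroup.of t) (FreeGroup.of s) (M s t))⁻¹}) ⟨s, t, hst, h0, rfl⟩
  rw [map_mul, map_inv, mul_inv_eq_one, map_altProd, map_altProd] at h
  exact h

variable {G : Type*} [Group G]

/-- The universal property of Artin groups. -/
def lift (f : B → G)
    (hf : ∀ s t, s ≠ t → M s t ≠ 0 → altProd (f s) (f t) (M s t) = altProd (f t) (f s) (M s t)) :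
    M.ArtinGroup →* G :=
  PresentedGroup.toGroup (f := f) (by
    rintro r ⟨s, t, hst, h0, rfl⟩
    rw [map_mul, map_inv, mul_inv_eq_one, map_altProd, map_altProd, FreeGroup.lift_apply_of,
      FreeGroup.lift_apply_of]
    exact hf s t hst h0)

theorem lift_of (f : B → G)
    (hf : ∀ s t, s ≠ t → M s t ≠ 0 → altProd (f s) (f t) (M s t) = altProd (f t) (f s) (M s t))
    (s : B) : lift M f hf (of M s) = f s :=
  PresentedGroup.toGroup.of _

variable {M}

theorem hom_ext {f g : M.ArtinGroup →* G} (h : ∀ s, f (of M s) = g (of M s)) : f = g :=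
  PresentedGroup.ext h

end ArtinGroup

section Parabolic

variable {M} {B' : Type*} {M' : CoxeterMatrix B'} {j : B' → B}

theorem IsMinimalRep.not_exists_mul_simple {w : M.Group} (hw : M.IsMinimalRep j w) {s : B} :
    ¬ ∃ x, M.rep (w * M.simple s) (simpleRoot s) = simpleRoot (j x) := by
  rintro ⟨x, hx⟩
  rw [map_mul, Module.End.mul_apply, rep_simple, simpleReflection_self, map_neg] at hx
  have h := hw x
  rw [← hx, map_neg, rep_inv_apply, neg_nonneg] at h
  exact not_simpleRoot_nonpos s h

variable (M M' j)

/-- The set on which an Artin group acts, with a free orbit of its parabolic subgroup. -/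
abbrev ArtinState : Type _ := M'.ArtinGroup × {w : M.Group // M.IsMinimalRep j w}

variable {M M' j}

open Classical in
/-- Right multiplication by a standard generator `s` on pairs `(a, w)`: it multiplies `a` by a
standard generator of the parabolic subgroup if `w s w⁻¹` is one, and `w` by `s` otherwise. -/
noncomputable def artinStep (s : B) (y : ArtinState M M' j) : ArtinState M M' j :=
  if h : ∃ x, M.rep y.2 (simpleRoot s) = simpleRoot (j x) then
    (y.1 * ArtinGroup.of M' h.choose, y.2)
  else (y.1, ⟨y.2 * M.simple s, y.2.2.mul_simple h⟩)

open Classical in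
/-- The inverse of `artinStep`. -/
noncomputable def artinStepInv (s : B) (y : ArtinState M M' j) : ArtinState M M' j :=
  if h : ∃ x, M.rep y.2 (simpleRoot s) = simpleRoot (j x) then
    (y.1 * (ArtinGroup.of M' h.choose)⁻¹, y.2)
  else (y.1, ⟨y.2 * M.simple s, y.2.2.mul_simple h⟩)

/-- `artinStep` as a permutation. -/
noncomputable def artinPerm (s : B) : Equiv.Perm (ArtinState M M' j) where
  toFun := artinStep s
  invFun := artinStepInv s
  left_inv y := by
    by_cases h : ∃ x, M.rep y.2 (simpleRoot s) = simpleRoot (j x)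
    · have e : artinStep s y = (y.1 * ArtinGroup.of M' h.choose, y.2) := dif_pos h
      rw [e, artinStepInv, dif_pos h, mul_inv_cancel_right]
    · have e : artinStep s y = (y.1, ⟨y.2 * M.simple s, y.2.2.mul_simple h⟩) := dif_neg h
      rw [e, artinStepInv, dif_neg y.2.2.not_exists_mul_simple]
      simp [mul_assoc, simple_mul_self]
  right_inv y := by
    by_cases h : ∃ x, M.rep y.2 (simpleRoot s) = simpleRoot (j x)
    · have e : artinStepInv s y = (y.1 * (ArtinGroup.of M' h.choose)⁻¹, y.2) := dif_pos h
      rw [e, artinStep, dif_pos h, inv_mul_cancel_right]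
    · have e : artinStepInv s y = (y.1, ⟨y.2 * M.simple s, y.2.2.mul_simple h⟩) := dif_neg h
      rw [e, artinStep, dif_neg y.2.2.not_exists_mul_simple]
      simp [mul_assoc, simple_mul_self]

theorem artinStep_of_eq (hj : Function.Injective j) {s : B} {y : ArtinState M M' j} {x : B'}
    (h : M.rep y.2 (simpleRoot s) = simpleRoot (j x)) :
    artinStep s y = (y.1 * ArtinGroup.of M' x, y.2) := by
  have h' : ∃ x, M.rep y.2 (simpleRoot s) = simpleRoot (j x) := ⟨x, h⟩
  have hx : h'.choose = x := hj (simpleRoot_injective (h'.choose_spec.symm.trans h))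
  rw [artinStep, dif_pos h', hx]

theorem artinStep_of_not {s : B} {y : ArtinState M M' j}
    (h : ¬ ∃ x, M.rep y.2 (simpleRoot s) = simpleRoot (j x)) :
    artinStep s y = (y.1, ⟨y.2 * M.simple s, y.2.2.mul_simple h⟩) := dif_neg h

/-- The orbit of `y` under alternating steps `s`, `t`, `s`, …. -/
noncomputable def artinPath (s t : B) (y : ArtinState M M' j) : ℕ → ArtinState M M' j
  | 0 => y
  | k + 1 => artinStep (if k % 2 = 0 then s else t) (artinPath s t y k)

theorem inv_altProd_artinPerm (s t : B) (y : ArtinState M M' j) (k : ℕ) :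
    (altProd (artinPerm s)⁻¹ (artinPerm t)⁻¹ k)⁻¹ y = artinPath s t y k := by
  induction k with
  | zero => simp [altProd_zero, artinPath]
  | succ k ih =>
    rw [altProd_succ, mul_inv_rev, Equiv.Perm.mul_apply, ih, artinPath]
    split_ifs <;> rw [inv_inv] <;> rfl

theorem artinPath_of_eq (hj : Function.Injective j) {s t : B} {y : ArtinState M M' j} {a b : B'}
    (hs : M.rep y.2 (simpleRoot s) = simpleRoot (j a))
    (ht : M.rep y.2 (simpleRoot t) = simpleRoot (j b)) (k : ℕ) :
    artinPath s t y k = (y.1 * altProd (ArtinGroup.of M' a) (ArtinGroup.of M' b) k, y.2) := by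
  induction k with
  | zero => simp [altProd_zero, artinPath]
  | succ k ih =>
    rw [artinPath, ih, altProd_succ]
    rcases Nat.mod_two_eq_zero_or_one k with h | h
    · simp only [h, if_true]
      exact (artinStep_of_eq hj
        (y := (y.1 * altProd (ArtinGroup.of M' a) (ArtinGroup.of M' b) k, y.2)) hs).trans
        (Prod.ext (mul_assoc _ _ _) rfl)
    · simp only [h, one_ne_zero, if_false]
      exact (artinStep_of_eq hj
        (y := (y.1 * altProd (ArtinGroup.of M' a) (ArtinGroup.of M' b) k, y.2)) ht).trans
        (Prod.ext (mul_assoc _ _ _) rfl)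

variable (M) in
/-- The roots `w α_s`, `w s α_t`, `w s t α_s`, …. -/
noncomputable def pathRoot (w : M.Group) (s t : B) (k : ℕ) : B →₀ ℝ :=
  M.rep (w * altProd (M.simple s) (M.simple t) k) (simpleRoot (if k % 2 = 0 then s else t))

theorem pathRoot_eq (w : M.Group) (s t : B) (k : ℕ) :
    M.pathRoot w s t k = sinQuot (M.cosAngle s t) (k + 1) • M.rep w (simpleRoot s) +
      sinQuot (M.cosAngle s t) k • M.rep w (simpleRoot t) := by
  rw [pathRoot, map_mul, Module.End.mul_apply, rep_altProd, map_add, map_smul, map_smul]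

theorem pathRoot_comm (w : M.Group) {s t : B} (hst : s ≠ t) {k : ℕ} (hk : k < M s t) :
    M.pathRoot w t s (M s t - 1 - k) = M.pathRoot w s t k := by
  have hm := M.two_le_of_ne hst (by omega)
  have e1 : M s t - 1 - k + 1 = M s t - k := by omega
  have e2 : M s t - 1 - k = M s t - (k + 1) := by omega
  rw [pathRoot_eq, pathRoot_eq, M.cosAngle_comm t s, e1, e2, cosAngle, sinQuot_sub hm hk.le,
    sinQuot_sub hm hk, add_comm]

theorem mem_of_pathRoot_mem {V : Submodule ℝ (B →₀ ℝ)} {w : M.Group} {s t : B} (hst : s ≠ t)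
    {k l : ℕ} (hkl : k < l) (hl : l < M s t) (hk : M.pathRoot w s t k ∈ V)
    (hl' : M.pathRoot w s t l ∈ V) :
    M.rep w (simpleRoot s) ∈ V ∧ M.rep w (simpleRoot t) ∈ V := by
  have hd := sinQuot_cross (M.two_le_of_ne hst (by omega)) hkl hl
  rw [pathRoot_eq] at hk hl'
  rw [← cosAngle] at hd
  constructor
  · rw [← Submodule.smul_mem_iff V hd]
    convert V.sub_mem (V.smul_mem (sinQuot (M.cosAngle s t) l) hk)
      (V.smul_mem (sinQuot (M.cosAngle s t) k) hl') using 1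
    module
  · rw [← Submodule.smul_mem_iff V hd]
    convert V.sub_mem (V.smul_mem (sinQuot (M.cosAngle s t) (k + 1)) hl')
      (V.smul_mem (sinQuot (M.cosAngle s t) (l + 1)) hk) using 1
    module

theorem artinPath_of_unique (hj : Function.Injective j) {s t : B} (y : ArtinState M M' j) {m : ℕ}
    (h : ∀ k l, k < l → l < m → M.pathRoot y.2 s t k ∈ parabolicSpan j →
      M.pathRoot y.2 s t l ∉ parabolicSpan j) {n : ℕ} (hn : n ≤ m) :
    ((∀ k < n, M.pathRoot y.2 s t k ∉ parabolicSpan j) ∧ (artinPath s t y n).1 = y.1 ∧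
      ((artinPath s t y n).2 : M.Group) = y.2 * altProd (M.simple s) (M.simple t) n) ∨
    ∃ k < n, ∃ x, M.pathRoot y.2 s t k = simpleRoot (j x) ∧
      (artinPath s t y n).1 = y.1 * ArtinGroup.of M' x ∧
      ((artinPath s t y n).2 : M.Group) =
        M.simple (j x) * (y.2 * altProd (M.simple s) (M.simple t) n) := by
  induction n with
  | zero => exact .inl ⟨by simp, rfl, by simp [artinPath, altProd_zero]⟩
  | succ n ih =>
    obtain ⟨r, hr⟩ : ∃ r, r = if n % 2 = 0 then s else t := ⟨_, rfl⟩
    have hpath : artinPath s t y (n + 1) = artinStep r (artinPath s t y n) := by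
      rw [hr, artinPath]
    have hroot : M.pathRoot y.2 s t n =
        M.rep (y.2 * altProd (M.simple s) (M.simple t) n) (simpleRoot r) := by
      rw [hr, pathRoot]
    have hprod : (y.2 : M.Group) * altProd (M.simple s) (M.simple t) (n + 1) =
        y.2 * altProd (M.simple s) (M.simple t) n * M.simple r := by
      rw [altProd_succ, mul_assoc, hr]
      split_ifs <;> rfl
    rw [hpath, hprod]
    rcases ih (by omega) with ⟨hno, h1, h2⟩ | ⟨k, hk, x, hx, h1, h2⟩
    · rw [← h2] at hroot ⊢
      by_cases hex : ∃ x, M.rep (artinPath s t y n).2 (simpleRoot r) = simpleRoot (j x)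
      · obtain ⟨x, hx⟩ := hex
        refine .inr ⟨n, by omega, x, hroot.trans hx, ?_⟩
        rw [artinStep_of_eq hj hx, h1, M.conj_simple hx, ← mul_assoc, simple_mul_self, one_mul]
        exact ⟨rfl, rfl⟩
      · refine .inl ⟨fun k hk hmem => ?_, ?_⟩
        · rcases Nat.lt_succ_iff_lt_or_eq.1 hk with hk | rfl
          · exact hno k hk hmem
          · rw [hroot] at hmem
            exact hex ((artinPath s t y k).2.2.exists_eq_simpleRoot hmem)
        · rw [artinStep_of_not hex]
          exact ⟨h1, rfl⟩
    · refine .inr ⟨k, by omega, x, hx, ?_⟩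
      by_cases hex : ∃ x, M.rep (artinPath s t y n).2 (simpleRoot r) = simpleRoot (j x)
      · exfalso
        obtain ⟨z, hz⟩ := hex
        refine h k n hk (by omega) (hx ▸ simpleRoot_mem_parabolicSpan j x) ?_
        rw [h2, map_mul, Module.End.mul_apply, rep_simple, ← hroot] at hz
        have := simpleReflection_mem_parabolicSpan (M := M) x
          (hz ▸ simpleRoot_mem_parabolicSpan j z)
        rwa [← Module.End.mul_apply, simpleReflection_mul_self, Module.End.one_apply] at this
      · rw [artinStep_of_not hex]
        refine ⟨h1, ?_⟩
        rw [← mul_assoc, ← h2]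

theorem artinPath_comm (hj : Function.Injective j) (hM : ∀ x y, M' x y = M (j x) (j y)) {s t : B}
    (hst : s ≠ t) (h0 : M s t ≠ 0) (y : ArtinState M M' j) :
    artinPath s t y (M s t) = artinPath t s y (M s t) := by
  by_cases hV : M.rep y.2 (simpleRoot s) ∈ parabolicSpan j ∧
      M.rep y.2 (simpleRoot t) ∈ parabolicSpan j
  · obtain ⟨a, ha⟩ := y.2.2.exists_eq_simpleRoot hV.1
    obtain ⟨b, hb⟩ := y.2.2.exists_eq_simpleRoot hV.2
    have hm : M s t = M' a b := by rw [hM, M.apply_eq_of_rep_eq ha hb]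
    have hab : a ≠ b := by
      rintro rfl
      exact hst (simpleRoot_injective (M.rep_injective _ (ha.trans hb.symm)))
    rw [artinPath_of_eq hj ha hb, artinPath_of_eq hj hb ha, hm,
      ArtinGroup.altProd_of_comm M' hab (hm ▸ h0)]
  · have hts : M t s = M s t := M.symmetric t s
    have u1 : ∀ k l, k < l → l < M s t → M.pathRoot y.2 s t k ∈ parabolicSpan j →
        M.pathRoot y.2 s t l ∉ parabolicSpan j :=
      fun k l hkl hl h1 h2 => hV (mem_of_pathRoot_mem hst hkl hl h1 h2)
    have u2 : ∀ k l, k < l → l < M s t → M.pathRoot y.2 t s k ∈ parabolicSpan j →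
        M.pathRoot y.2 t s l ∉ parabolicSpan j :=
      fun k l hkl hl h1 h2 =>
        hV (mem_of_pathRoot_mem hst.symm hkl (hts ▸ hl) h1 h2).symm
    have hcomm : ∀ k, k < M s t → M.pathRoot y.2 t s k = M.pathRoot y.2 s t (M s t - 1 - k) := by
      intro k hk
      rw [← pathRoot_comm _ hst (by omega : M s t - 1 - k < M s t)]
      congr 1
      omega
    rcases artinPath_of_unique hj y u1 le_rfl with ⟨hno, h1, h2⟩ | ⟨k, hk, x, hx, h1, h2⟩ <;>
      rcases artinPath_of_unique hj y u2 le_rfl with ⟨hno', h1', h2'⟩ | ⟨l, hl, z, hz, h1', h2'⟩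
    · exact Prod.ext (h1.trans h1'.symm)
        (Subtype.ext (by rw [h2, h2', altProd_simple_comm]))
    · exact absurd (hcomm l hl ▸ hz ▸ simpleRoot_mem_parabolicSpan j z) (hno _ (by omega))
    · refine absurd ?_ (hno' (M s t - 1 - k) (by omega))
      rw [pathRoot_comm _ hst hk, hx]
      exact simpleRoot_mem_parabolicSpan j x
    · have hkl : k = M s t - 1 - l := by
        rw [hcomm l hl] at hz
        have m1 := hx ▸ simpleRoot_mem_parabolicSpan j x
        have m2 := hz ▸ simpleRoot_mem_parabolicSpan j z
        rcases lt_trichotomy k (M s t - 1 - l) with h | h | h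
        · exact absurd m2 (u1 _ _ h (by omega) m1)
        · exact h
        · exact absurd m1 (u1 _ _ h hk m2)
      have hxz : x = z := by
        rw [hcomm l hl, ← hkl, hx] at hz
        exact hj (simpleRoot_injective hz)
      exact Prod.ext (by rw [h1, h1', hxz])
        (Subtype.ext (by rw [h2, h2', hxz, altProd_simple_comm]))

/-- The homomorphism of Artin groups induced by an inclusion of Coxeter matrices. -/
def ArtinGroup.map (hj : Function.Injective j) (hM : ∀ x y, M' x y = M (j x) (j y)) :
    M'.ArtinGroup →* M.ArtinGroup :=
  ArtinGroup.lift M' (fun x => ArtinGroup.of M (j x)) fun x y hxy h0 => by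
    rw [hM] at h0 ⊢
    exact ArtinGroup.altProd_of_comm M (hj.ne hxy) h0

theorem ArtinGroup.map_of (hj : Function.Injective j) (hM : ∀ x y, M' x y = M (j x) (j y))
    (x : B') : ArtinGroup.map hj hM (ArtinGroup.of M' x) = ArtinGroup.of M (j x) :=
  ArtinGroup.lift_of _ _ _ _

/-- Van der Lek's theorem: standard parabolic subgroups of Artin groups are Artin groups. -/
theorem ArtinGroup.map_injective (hj : Function.Injective j)
    (hM : ∀ x y, M' x y = M (j x) (j y)) : Function.Injective (ArtinGroup.map hj hM) := by
  let F : M.ArtinGroup →* Equiv.Perm (ArtinState M M' j) :=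
    ArtinGroup.lift M (fun s => (artinPerm s)⁻¹) fun s t hst h0 => by
      rw [← inv_inj]
      ext1 y
      rw [inv_altProd_artinPerm, inv_altProd_artinPerm, artinPath_comm hj hM hst h0]
  have hF : ∀ b a, F (ArtinGroup.map hj hM b) (a, ⟨1, M.isMinimalRep_one j⟩) =
      (a * b⁻¹, ⟨1, M.isMinimalRep_one j⟩) := by
    intro b
    have hb : b ∈ (⊤ : Subgroup M'.ArtinGroup) := trivial
    have hgen : Subgroup.closure (Set.range (ArtinGroup.of M')) = ⊤ :=
      PresentedGroup.closure_range_of _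
    rw [← hgen] at hb
    have hof : ∀ x a, artinStep (j x) ((a, ⟨1, M.isMinimalRep_one j⟩) : ArtinState M M' j) =
        (a * ArtinGroup.of M' x, ⟨1, M.isMinimalRep_one j⟩) := fun x a =>
      artinStep_of_eq hj (by rw [map_one, Module.End.one_apply])
    induction hb using Subgroup.closure_induction with
    | mem b hb =>
      obtain ⟨x, rfl⟩ := hb
      intro a
      rw [ArtinGroup.map_of, ArtinGroup.lift_of, Equiv.Perm.inv_eq_iff_eq]
      exact ((hof x _).trans (by rw [inv_mul_cancel_right])).symm
    | one => intro a; simp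
    | mul b c _ _ hb hc =>
      intro a
      rw [map_mul, map_mul, Equiv.Perm.mul_apply, hc, hb, mul_inv_rev, mul_assoc]
    | inv b _ hb =>
      intro a
      rw [map_inv, map_inv, Equiv.Perm.inv_eq_iff_eq, hb, inv_inv, mul_inv_cancel_right]
  refine (injective_iff_map_eq_one _).2 fun b hb => ?_
  have := hF b 1
  rw [hb, map_one, Equiv.Perm.one_apply, one_mul] at this
  exact (inv_eq_one.1 (congrArg Prod.fst this).symm)

end Parabolic

section RootMatrix

open Classical in
/-- The Coxeter matrix on the vectors of the reflection representation with entry `m_{s,t}` at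
`(w α_s, w α_t)` and no other finite entries off the diagonal. -/
noncomputable def rootEntry (v u : B →₀ ℝ) : ℕ :=
  if h : ∃ n w s t, M.rep w (simpleRoot s) = v ∧ M.rep w (simpleRoot t) = u ∧ M s t = n then
    h.choose
  else if v = u then 1 else 0

variable {M}

theorem rootEntry_eq {v u : B →₀ ℝ} {w : M.Group} {s t : B} (hs : M.rep w (simpleRoot s) = v)
    (ht : M.rep w (simpleRoot t) = u) : M.rootEntry v u = M s t := by
  have h : ∃ n w s t, M.rep w (simpleRoot s) = v ∧ M.rep w (simpleRoot t) = u ∧ M s t = n :=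
    ⟨_, w, s, t, hs, ht, rfl⟩
  obtain ⟨w', s', t', hs', ht', hn⟩ := h.choose_spec
  rw [rootEntry, dif_pos h, ← hn]
  apply M.apply_eq_of_rep_eq (w := w⁻¹ * w') <;> rw [map_mul, Module.End.mul_apply]
  · rw [hs', ← hs, rep_inv_apply]
  · rw [ht', ← ht, rep_inv_apply]

theorem rootEntry_eq_zero {v u : B →₀ ℝ} (hvu : v ≠ u)
    (h : ¬ ∃ w s t, M.rep w (simpleRoot s) = v ∧ M.rep w (simpleRoot t) = u) :
    M.rootEntry v u = 0 := by
  rw [rootEntry, dif_neg, if_neg hvu]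
  rintro ⟨-, w, s, t, hs, ht, -⟩
  exact h ⟨w, s, t, hs, ht⟩

theorem rootEntry_self (v : B →₀ ℝ) : M.rootEntry v v = 1 := by
  by_cases h : ∃ w s, M.rep w (simpleRoot s) = v
  · obtain ⟨w, s, hs⟩ := h
    rw [rootEntry_eq hs hs, M.diagonal]
  · rw [rootEntry, dif_neg, if_pos rfl]
    rintro ⟨-, w, s, -, hs, -⟩
    exact h ⟨w, s, hs⟩

theorem exists_of_rootEntry_ne_zero {v u : B →₀ ℝ} (hvu : v ≠ u) (h0 : M.rootEntry v u ≠ 0) :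
    ∃ w s t, s ≠ t ∧ M.rep w (simpleRoot s) = v ∧ M.rep w (simpleRoot t) = u := by
  by_contra h
  refine h0 (rootEntry_eq_zero hvu ?_)
  rintro ⟨w, s, t, hs, ht⟩
  refine h ⟨w, s, t, ?_, hs, ht⟩
  rintro rfl
  exact hvu (hs.symm.trans ht)

variable (M) in
/-- The Coxeter matrix with entries `rootEntry`. -/
noncomputable def rootMatrix : CoxeterMatrix (B →₀ ℝ) where
  M := Matrix.of M.rootEntry
  isSymm := Matrix.IsSymm.ext fun v u => by
    change M.rootEntry u v = M.rootEntry v u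
    by_cases hvu : v = u
    · rw [hvu]
    by_cases h : ∃ w s t, M.rep w (simpleRoot s) = v ∧ M.rep w (simpleRoot t) = u
    · obtain ⟨w, s, t, hs, ht⟩ := h
      rw [rootEntry_eq hs ht, rootEntry_eq ht hs, M.symmetric]
    · rw [rootEntry_eq_zero hvu h, rootEntry_eq_zero (Ne.symm hvu)]
      rintro ⟨w, t, s, ht, hs⟩
      exact h ⟨w, s, t, hs, ht⟩
  diagonal := rootEntry_self
  off_diagonal := fun v u hvu h1 => by
    change M.rootEntry v u = 1 at h1
    obtain ⟨w, s, t, hst, hs, ht⟩ := exists_of_rootEntry_ne_zero hvu (h1 ▸ one_ne_zero)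
    rw [rootEntry_eq hs ht] at h1
    exact M.off_diagonal s t hst h1

theorem rootMatrix_apply (v u : B →₀ ℝ) : M.rootMatrix v u = M.rootEntry v u := rfl

theorem rootMatrix_map {B' : Type*} {M' : CoxeterMatrix B'} {f : (B' →₀ ℝ) → B →₀ ℝ}
    (hf : Function.Injective f)
    (h1 : ∀ w s t, ∃ w' s' t', M.rep w' (simpleRoot s') = f (M'.rep w (simpleRoot s)) ∧
      M.rep w' (simpleRoot t') = f (M'.rep w (simpleRoot t)) ∧ M' s t = M s' t')
    (h2 : ∀ w s t v u, M.rep w (simpleRoot s) = f v → M.rep w (simpleRoot t) = f u →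
      ∃ w' s' t', M'.rep w' (simpleRoot s') = v ∧ M'.rep w' (simpleRoot t') = u)
    (v u : B' →₀ ℝ) : M'.rootMatrix v u = M.rootMatrix (f v) (f u) := by
  rw [rootMatrix_apply, rootMatrix_apply]
  by_cases hvu : v = u
  · rw [hvu, rootEntry_self, rootEntry_self]
  by_cases h : ∃ w s t, M'.rep w (simpleRoot s) = v ∧ M'.rep w (simpleRoot t) = u
  · obtain ⟨w, s, t, rfl, rfl⟩ := h
    obtain ⟨w', s', t', hs, ht, hst⟩ := h1 w s t
    rw [rootEntry_eq rfl rfl, rootEntry_eq hs ht, hst]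
  · rw [rootEntry_eq_zero hvu h, rootEntry_eq_zero (hf.ne hvu)]
    rintro ⟨w, s, t, hs, ht⟩
    exact h (h2 w s t v u hs ht)

theorem rootMatrix_rep (w : M.Group) (v u : B →₀ ℝ) :
    M.rootMatrix v u = M.rootMatrix (M.rep w v) (M.rep w u) := by
  refine rootMatrix_map (M.rep_injective w) (fun w' s t => ⟨w * w', s, t, ?_, ?_, rfl⟩)
    (fun w' s t v u hs ht => ⟨w⁻¹ * w', s, t, ?_, ?_⟩) v u
  · rw [map_mul, Module.End.mul_apply]
  · rw [map_mul, Module.End.mul_apply]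
  · rw [map_mul, Module.End.mul_apply, hs, rep_inv_apply]
  · rw [map_mul, Module.End.mul_apply, ht, rep_inv_apply]

/-- The automorphism of the Artin group of `M.rootMatrix` permuting its generators by `w`. -/
noncomputable def rootAut (w : M.Group) : MulAut M.rootMatrix.ArtinGroup :=
  MonoidHom.toMulEquiv (ArtinGroup.map (M.rep_injective w) (rootMatrix_rep w))
    (ArtinGroup.map (M.rep_injective w⁻¹) (rootMatrix_rep w⁻¹))
    (ArtinGroup.hom_ext fun v => by
      rw [MonoidHom.comp_apply, ArtinGroup.map_of, ArtinGroup.map_of, rep_inv_apply,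
        MonoidHom.id_apply])
    (ArtinGroup.hom_ext fun v => by
      rw [MonoidHom.comp_apply, ArtinGroup.map_of, ArtinGroup.map_of, rep_apply_inv,
        MonoidHom.id_apply])

theorem rootAut_of (w : M.Group) (v : B →₀ ℝ) :
    rootAut w (ArtinGroup.of _ v) = ArtinGroup.of _ (M.rep w v) :=
  ArtinGroup.map_of (M.rep_injective w) (rootMatrix_rep w) v

variable (M) in
/-- The action of the Coxeter group on the Artin group of `M.rootMatrix`. -/
noncomputable def rootAction : M.Group →* MulAut M.rootMatrix.ArtinGroup where
  toFun := rootAut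
  map_one' := MulEquiv.toMonoidHom_injective <| ArtinGroup.hom_ext fun v => by
    change rootAut 1 _ = ArtinGroup.of _ v
    rw [rootAut_of, map_one, Module.End.one_apply]
  map_mul' w w' := MulEquiv.toMonoidHom_injective <| ArtinGroup.hom_ext fun v => by
    change rootAut (w * w') (ArtinGroup.of _ v) = rootAut w (rootAut w' (ArtinGroup.of _ v))
    rw [rootAut_of, rootAut_of, rootAut_of, map_mul, Module.End.mul_apply]

theorem rootAction_of (w : M.Group) (v : B →₀ ℝ) :
    M.rootAction w (ArtinGroup.of _ v) = ArtinGroup.of _ (M.rep w v) :=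
  rootAut_of w v

theorem rep_altProd_sub_one {s t : B} (hst : s ≠ t) (h0 : M s t ≠ 0) :
    M.rep (altProd (M.simple t) (M.simple s) (M s t - 1))
      (simpleRoot (if Even (M s t) then s else t)) = simpleRoot s := by
  have hm := M.two_le_of_ne hst h0
  have e : (if Even (M s t) then s else t) = if (M s t - 1) % 2 = 0 then t else s := by
    rcases Nat.even_or_odd (M s t) with h | h
    · have h' := h
      rw [Nat.even_iff] at h'
      rw [if_pos h, if_neg (by omega)]
    · have h' := h
      rw [Nat.odd_iff] at h'
      rw [if_neg (Nat.not_even_iff_odd.2 h), if_pos (by omega)]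
  rw [e, rep_altProd, M.cosAngle_comm t s, cosAngle, Nat.sub_add_cancel (by omega),
    sinQuot_self hm, sinQuot_sub hm (by omega)]
  simp [sinQuot]

end RootMatrix

section ParabolicHom

variable {M} {B' : Type*} {M' : CoxeterMatrix B'} {j : B' → B}

/-- The linear map sending the simple root `α_x` to `α_{j x}`. -/
noncomputable def rootMap (j : B' → B) : (B' →₀ ℝ) →ₗ[ℝ] B →₀ ℝ := Finsupp.lmapDomain ℝ ℝ j

theorem rootMap_simpleRoot (x : B') : rootMap j (simpleRoot x) = simpleRoot (j x) := by
  simp [rootMap]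

theorem rootMap_injective (hj : Function.Injective j) : Function.Injective (rootMap j) :=
  Finsupp.mapDomain_injective hj

theorem rootMap_mem_parabolicSpan (v : B' →₀ ℝ) : rootMap j v ∈ parabolicSpan j := by
  induction v using Finsupp.induction_linear with
  | zero => simp
  | add u v hu hv => rw [map_add]; exact add_mem hu hv
  | single x c =>
    rw [← Finsupp.smul_single_one, map_smul, rootMap_simpleRoot]
    exact Submodule.smul_mem _ _ (simpleRoot_mem_parabolicSpan j x)

theorem isLiftable_simple_comp (hM : ∀ x y, M' x y = M (j x) (j y)) :
    M'.IsLiftable fun x => M.simple (j x) := fun x y => by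
  rw [hM]
  exact M.toCoxeterSystem.simple_mul_simple_pow (j x) (j y)

/-- The homomorphism of Coxeter groups induced by an inclusion of Coxeter matrices. -/
def groupMap (hM : ∀ x y, M' x y = M (j x) (j y)) : M'.Group →* M.Group :=
  M'.toCoxeterSystem.lift ⟨fun x => M.simple (j x), isLiftable_simple_comp hM⟩

theorem groupMap_simple (hM : ∀ x y, M' x y = M (j x) (j y)) (x : B') :
    groupMap hM (M'.simple x) = M.simple (j x) := by
  rw [groupMap, ← M'.toCoxeterSystem_simple, CoxeterSystem.lift_apply_simple]

theorem closure_range_simple : Subgroup.closure (Set.range M.simple) = ⊤ :=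
  M.toCoxeterSystem.subgroup_closure_range_simple

theorem rep_groupMap (hM : ∀ x y, M' x y = M (j x) (j y)) (w : M'.Group) (v : B' →₀ ℝ) :
    M.rep (groupMap hM w) (rootMap j v) = rootMap j (M'.rep w v) := by
  have hw : w ∈ Subgroup.closure (Set.range M'.simple) := closure_range_simple ▸ trivial
  induction hw using Subgroup.closure_induction generalizing v with
  | mem w hw =>
    obtain ⟨x, rfl⟩ := hw
    rw [groupMap_simple, rep_simple, rep_simple]
    induction v using Finsupp.induction_linear with
    | zero => simp
    | add u v hu hv => rw [map_add, map_add, map_add, map_add, hu, hv]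
    | single y c =>
      rw [← Finsupp.smul_single_one, map_smul, map_smul, map_smul, map_smul, rootMap_simpleRoot,
        simpleReflection_simpleRoot, simpleReflection_simpleRoot, map_add, map_smul,
        rootMap_simpleRoot, rootMap_simpleRoot, cosAngle, cosAngle, hM]
  | one => simp
  | mul w w' _ _ h h' =>
    rw [map_mul, map_mul, map_mul, Module.End.mul_apply, Module.End.mul_apply, h', h]
  | inv w _ h =>
    apply M.rep_injective (groupMap hM w)
    rw [h, map_inv, rep_apply_inv, rep_apply_inv]

theorem groupMap_injective (hj : Function.Injective j) (hM : ∀ x y, M' x y = M (j x) (j y)) :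
    Function.Injective (groupMap hM) := by
  refine (injective_iff_map_eq_one _).2 fun w hw => M'.eq_one_of_rep_eq fun x => ?_
  apply rootMap_injective hj
  rw [← rep_groupMap hM, hw, map_one, Module.End.one_apply]

theorem exists_groupMap_mul (hM : ∀ x y, M' x y = M (j x) (j y)) (w : M.Group) :
    ∃ u v, M.IsMinimalRep j v ∧ w = groupMap hM u * v := by
  obtain ⟨u, hu, v, hv, h⟩ := M.exists_mul_isMinimalRep j w
  have : Subgroup.closure (Set.range fun x => M.simple (j x)) ≤ (groupMap hM).range := by
    rw [Subgroup.closure_le]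
    rintro - ⟨x, rfl⟩
    exact ⟨_, groupMap_simple hM x⟩
  obtain ⟨u, rfl⟩ := this hu
  exact ⟨u, v, hv, h⟩

theorem rootMatrix_rootMap (hj : Function.Injective j) (hM : ∀ x y, M' x y = M (j x) (j y))
    (v u : B' →₀ ℝ) : M'.rootMatrix v u = M.rootMatrix (rootMap j v) (rootMap j u) := by
  refine rootMatrix_map (rootMap_injective hj)
    (fun w x y => ⟨groupMap hM w, j x, j y, ?_, ?_, hM x y⟩) (fun w s t v u hs ht => ?_) v u
  · rw [← rep_groupMap hM, rootMap_simpleRoot]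
  · rw [← rep_groupMap hM, rootMap_simpleRoot]
  · obtain ⟨w₁, w₂, hw₂, rfl⟩ := exists_groupMap_mul hM w
    have key : ∀ r v, M.rep (groupMap hM w₁ * w₂) (simpleRoot r) = rootMap j v →
        ∃ x, M'.rep w₁ (simpleRoot x) = v := by
      intro r v hr
      have h : M.rep w₂ (simpleRoot r) = rootMap j (M'.rep w₁⁻¹ v) := by
        rw [← rep_groupMap hM, ← hr, map_mul, Module.End.mul_apply, map_inv, rep_inv_apply]
      obtain ⟨x, hx⟩ := hw₂.exists_eq_simpleRoot (h ▸ rootMap_mem_parabolicSpan _)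
      rw [hx, ← rootMap_simpleRoot] at h
      exact ⟨x, by rw [rootMap_injective hj h, rep_apply_inv]⟩
    obtain ⟨x, hx⟩ := key s v hs
    obtain ⟨y, hy⟩ := key t u ht
    exact ⟨w₁, x, y, hx, hy⟩

end ParabolicHom

end CoxeterMatrix

namespace VirtualArtinGroup

open CoxeterMatrix

variable {S : Type*} (M : CoxeterMatrix S)

section Relations

variable {s t : S}

theorem altProd_sigma_comm (hst : s ≠ t) (h0 : M s t ≠ 0) :
    altProd (sigma M s) (sigma M t) (M s t) = altProd (sigma M t) (sigma M s) (M s t) := by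
  have h := PresentedGroup.one_of_mem (rels := vaRels M)
    (.inl (.inl (.inl ⟨s, t, hst, h0, rfl⟩)))
  rw [map_mul, map_inv, mul_inv_eq_one, map_altProd, map_altProd] at h
  exact h

theorem tau_mul_self (s : S) : tau M s * tau M s = 1 := by
  have h := PresentedGroup.one_of_mem (rels := vaRels M) (.inl (.inl (.inr ⟨s, rfl⟩)))
  rw [map_mul] at h
  exact h

theorem altProd_tau_comm (hst : s ≠ t) (h0 : M s t ≠ 0) :
    altProd (tau M s) (tau M t) (M s t) = altProd (tau M t) (tau M s) (M s t) := by
  have h := PresentedGroup.one_of_mem (rels := vaRels M) (.inl (.inr ⟨s, t, hst, h0, rfl⟩))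
  rw [map_mul, map_inv, mul_inv_eq_one, map_altProd, map_altProd] at h
  exact h

theorem sigma_mul_altProd_tau (hst : s ≠ t) (h0 : M s t ≠ 0) :
    sigma M s * altProd (tau M t) (tau M s) (M s t - 1) =
      altProd (tau M t) (tau M s) (M s t - 1) * sigma M (if Even (M s t) then s else t) := by
  have h := PresentedGroup.one_of_mem (rels := vaRels M) (.inr ⟨s, t, hst, h0, rfl⟩)
  rw [map_mul, map_inv, mul_inv_eq_one, map_mul, map_mul, map_altProd] at h
  exact h

end Relations

section Lift

variable {M} {G : Type*} [Group G] {f g : S → G}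

/-- The universal property of virtual Artin groups. -/
def lift
    (h1 : ∀ s t, s ≠ t → M s t ≠ 0 → altProd (f s) (f t) (M s t) = altProd (f t) (f s) (M s t))
    (h2 : ∀ s, g s * g s = 1)
    (h3 : ∀ s t, s ≠ t → M s t ≠ 0 → altProd (g s) (g t) (M s t) = altProd (g t) (g s) (M s t))
    (h4 : ∀ s t, s ≠ t → M s t ≠ 0 → f s * altProd (g t) (g s) (M s t - 1) =
      altProd (g t) (g s) (M s t - 1) * f (if Even (M s t) then s else t)) :
    VirtualArtinGroup M →* G :=
  PresentedGroup.toGroup (f := Sum.elim f g) (by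
    rintro r (((⟨s, t, hst, h0, rfl⟩ | ⟨s, rfl⟩) | ⟨s, t, hst, h0, rfl⟩) | ⟨s, t, hst, h0, rfl⟩)
    · simpa [map_altProd, mul_inv_eq_one] using h1 s t hst h0
    · simpa using h2 s
    · simpa [map_altProd, mul_inv_eq_one] using h3 s t hst h0
    · simpa only [map_mul, map_inv, mul_inv_eq_one, map_altProd, FreeGroup.lift_apply_of,
        Sum.elim_inl, Sum.elim_inr] using h4 s t hst h0)

variable
    (h1 : ∀ s t, s ≠ t → M s t ≠ 0 → altProd (f s) (f t) (M s t) = altProd (f t) (f s) (M s t))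
    (h2 : ∀ s, g s * g s = 1)
    (h3 : ∀ s t, s ≠ t → M s t ≠ 0 → altProd (g s) (g t) (M s t) = altProd (g t) (g s) (M s t))
    (h4 : ∀ s t, s ≠ t → M s t ≠ 0 → f s * altProd (g t) (g s) (M s t - 1) =
      altProd (g t) (g s) (M s t - 1) * f (if Even (M s t) then s else t))

theorem lift_sigma (s : S) : lift h1 h2 h3 h4 (sigma M s) = f s :=
  PresentedGroup.toGroup.of _

theorem lift_tau (s : S) : lift h1 h2 h3 h4 (tau M s) = g s :=
  PresentedGroup.toGroup.of _

theorem hom_ext {φ ψ : VirtualArtinGroup M →* G} (hs : ∀ s, φ (sigma M s) = ψ (sigma M s))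
    (ht : ∀ s, φ (tau M s) = ψ (tau M s)) : φ = ψ :=
  PresentedGroup.ext fun x => by
    rcases x with s | s
    · exact hs s
    · exact ht s

end Lift

theorem isLiftable_tau : M.IsLiftable (tau M) := by
  intro s t
  by_cases hst : s = t
  · rw [hst, tau_mul_self, one_pow]
  by_cases h0 : M s t = 0
  · rw [h0, pow_zero]
  · exact (altProd_comm_iff (tau_mul_self M s) (tau_mul_self M t) _).1 (altProd_tau_comm M hst h0)

/-- The homomorphism from the Coxeter group sending `s` to `τ_s`. -/
def tauHom : M.Group →* VirtualArtinGroup M := M.toCoxeterSystem.lift ⟨tau M, isLiftable_tau M⟩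

theorem tauHom_simple (s : S) : tauHom M (M.simple s) = tau M s := by
  rw [tauHom, ← M.toCoxeterSystem_simple, CoxeterSystem.lift_apply_simple]

theorem sigma_mul_tauHom_altProd {s t : S} (hst : s ≠ t) (h0 : M s t ≠ 0) :
    sigma M s * tauHom M (altProd (M.simple t) (M.simple s) (M s t - 1)) =
      tauHom M (altProd (M.simple t) (M.simple s) (M s t - 1)) *
        sigma M (if Even (M s t) then s else t) := by
  rw [map_altProd, tauHom_simple, tauHom_simple, sigma_mul_altProd_tau M hst h0]

theorem tauHom_mul_sigma {w : M.Group} {s t : S}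
    (h : M.rep w (simpleRoot s) = simpleRoot t) :
    tauHom M w * sigma M s = sigma M t * tauHom M w := by
  obtain ⟨n, hn⟩ : ∃ n, M.toCoxeterSystem.length w = n := ⟨_, rfl⟩
  induction n using Nat.strong_induction_on generalizing w s with
  | _ n ih =>
    by_cases hw : w = 1
    · rw [hw, map_one, Module.End.one_apply] at h
      rw [hw, simpleRoot_injective h, map_one, one_mul, mul_one]
    obtain ⟨r, hr⟩ := M.toCoxeterSystem.exists_rightDescent_of_ne_one hw
    rw [CoxeterSystem.IsRightDescent, toCoxeterSystem_simple] at hr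
    have hpos : 0 ≤ M.rep w (simpleRoot s) := h ▸ simpleRoot_nonneg t
    have hs := M.length_lt_of_rep_nonneg hpos
    have hsr : s ≠ r := by
      rintro rfl
      omega
    obtain ⟨k, v, hk, hv, hvk, hvs, hvr, hkm⟩ := M.exists_dihedral_factor w hs hr
    have hwv : w = v * (altProd (M.simple r) (M.simple s) k)⁻¹ := by
      rw [hv, mul_inv_cancel_right]
    have hdec := h
    rw [hwv, map_mul, Module.End.mul_apply, rep_inv_altProd, map_add, map_smul, map_smul] at hdec
    have hnn : ∀ c : Prop, [Decidable c] → 0 ≤ M.rep v (simpleRoot (if c then s else r)) := by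
      intro c _
      split_ifs
      · exact M.rep_simpleRoot_nonneg hvs
      · exact M.rep_simpleRoot_nonneg hvr
    have hU : 0 < sinQuot (M.cosAngle s r) k := M.sinQuot_cosAngle_pos hsr hk hkm
    obtain ⟨p, q, hpq, hp, hq⟩ : ∃ p q, p ≠ q ∧ p = (if k % 2 = 0 then s else r) ∧
        q = (if k % 2 = 0 then r else s) := by
      refine ⟨_, _, ?_, rfl, rfl⟩
      split_ifs
      · exact hsr
      · exact hsr.symm
    have hp0 : 0 ≤ M.rep v (simpleRoot p) := hp ▸ hnn _
    have hq0 : 0 ≤ M.rep v (simpleRoot q) := by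
      rw [hq]
      split_ifs
      · exact M.rep_simpleRoot_nonneg hvr
      · exact M.rep_simpleRoot_nonneg hvs
    rw [← hp, ← hq] at hdec
    have hkm' : M s r ≠ 0 ∧ k + 1 = M s r := by
      by_contra hne
      have hU' : 0 < sinQuot (M.cosAngle s r) (k + 1) :=
        M.sinQuot_cosAngle_pos hsr (by omega) (by omega)
      have hz : ∀ i, i ≠ t → M.rep v (simpleRoot p) i = 0 ∧ M.rep v (simpleRoot q) i = 0 := by
        intro i hi
        have := DFunLike.congr_fun hdec i
        rw [Finsupp.add_apply, Finsupp.smul_apply, Finsupp.smul_apply, smul_eq_mul, smul_eq_mul,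
          Finsupp.single_eq_of_ne hi] at this
        have a1 := hp0 i
        have a2 := hq0 i
        rw [Finsupp.zero_apply] at a1 a2
        constructor <;> nlinarith
      refine hpq (simpleRoot_injective (M.rep_injective v ?_))
      rw [M.rep_eq_simpleRoot hp0 fun i hi => (hz i hi).1,
        M.rep_eq_simpleRoot hq0 fun i hi => (hz i hi).2]
    obtain ⟨h0, hkm'⟩ := hkm'
    have hm := M.two_le_of_ne hsr h0
    have hk1 : k = M s r - 1 := by omega
    have hq' : q = if Even (M s r) then s else r := by
      rw [hq, ← hkm']
      rcases Nat.mod_two_eq_zero_or_one k with h | h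
      · rw [if_pos h, if_neg (by rw [Nat.even_iff]; omega)]
      · rw [if_neg (by omega), if_pos (by rw [Nat.even_iff]; omega)]
    have hvq : M.rep v (simpleRoot q) = simpleRoot t := by
      rw [hkm', hk1, cosAngle, sinQuot_self hm, sinQuot_sub hm (by omega)] at hdec
      simpa [sinQuot] using hdec
    have hel := sigma_mul_tauHom_altProd M hsr h0
    rw [← hq', ← hk1] at hel
    have hind := ih _ (by omega) hvq rfl
    rw [hwv, map_mul, map_inv, mul_assoc, ← mul_assoc (sigma M t), ← hind, mul_assoc]
    congr 1
    rw [inv_mul_eq_iff_eq_mul, ← mul_assoc, ← hel, mul_inv_cancel_right]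

section SemidirectProduct

/-- The semidirect product presentation of a virtual Artin group. -/
abbrev RootProduct : Type _ := M.rootMatrix.ArtinGroup ⋊[M.rootAction] M.Group

variable {M} in
theorem inl_mul_inr (w : M.Group) (v u : S →₀ ℝ) (h : M.rep w u = v) :
    (SemidirectProduct.inl (ArtinGroup.of _ v) * SemidirectProduct.inr w : RootProduct M) =
      SemidirectProduct.inr w * SemidirectProduct.inl (ArtinGroup.of _ u) := by
  rw [← h, ← rootAction_of, SemidirectProduct.inl_aut, map_inv, inv_mul_cancel_right]

/-- The homomorphism to the semidirect product sending `σ_s` to the Artin generator at the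
simple root `α_s` and `τ_s` to `s`. -/
noncomputable def toRootProduct : VirtualArtinGroup M →* RootProduct M :=
  lift (f := fun s => SemidirectProduct.inl (ArtinGroup.of _ (simpleRoot s)))
    (g := fun s => SemidirectProduct.inr (M.simple s))
    (fun s t hst h0 => by
      have hm : M.rootMatrix (simpleRoot s) (simpleRoot t) = M s t :=
        rootEntry_eq (w := 1) (by simp) (by simp)
      rw [← map_altProd, ← map_altProd, ← hm,
        ArtinGroup.altProd_of_comm _ (simpleRoot_injective.ne hst) (hm ▸ h0)])
    (fun s => by rw [← map_mul, simple_mul_self, map_one])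
    (fun s t _ _ => by rw [← map_altProd, ← map_altProd, altProd_simple_comm])
    (fun s t hst h0 => by
      rw [← map_altProd, inl_mul_inr _ _ _ (rep_altProd_sub_one hst h0)])

theorem toRootProduct_sigma (s : S) :
    toRootProduct M (sigma M s) = SemidirectProduct.inl (ArtinGroup.of _ (simpleRoot s)) :=
  lift_sigma _ _ _ _ s

theorem toRootProduct_tau (s : S) :
    toRootProduct M (tau M s) = SemidirectProduct.inr (M.simple s) :=
  lift_tau _ _ _ _ s

open Classical in
/-- The conjugate of a generator `σ_s` attached to a root `w α_s`. -/
noncomputable def rootSigma (v : S →₀ ℝ) : VirtualArtinGroup M :=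
  if h : ∃ g w s, M.rep w (simpleRoot s) = v ∧ g = tauHom M w * sigma M s * (tauHom M w)⁻¹ then
    h.choose
  else 1

theorem rootSigma_rep (w : M.Group) (s : S) :
    rootSigma M (M.rep w (simpleRoot s)) = tauHom M w * sigma M s * (tauHom M w)⁻¹ := by
  have h : ∃ g w' s', M.rep w' (simpleRoot s') = M.rep w (simpleRoot s) ∧
      g = tauHom M w' * sigma M s' * (tauHom M w')⁻¹ := ⟨_, w, s, rfl, rfl⟩
  obtain ⟨w', s', hv, hg⟩ := h.choose_spec
  rw [rootSigma, dif_pos h, hg]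
  have key : M.rep (w⁻¹ * w') (simpleRoot s') = simpleRoot s := by
    rw [map_mul, Module.End.mul_apply, hv, rep_inv_apply]
  have := tauHom_mul_sigma M key
  rw [map_mul, map_inv, mul_assoc, inv_mul_eq_iff_eq_mul] at this
  rw [this]
  group

theorem rootSigma_conj (w : M.Group) (v : S →₀ ℝ) :
    rootSigma M (M.rep w v) = tauHom M w * rootSigma M v * (tauHom M w)⁻¹ := by
  by_cases h : ∃ w' s, M.rep w' (simpleRoot s) = v
  · obtain ⟨w', s, rfl⟩ := h
    rw [← Module.End.mul_apply, ← map_mul, rootSigma_rep, rootSigma_rep, map_mul]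
    group
  · rw [rootSigma, dif_neg, rootSigma, dif_neg, mul_one, mul_inv_cancel]
    · rintro ⟨-, w', s, hv, -⟩
      exact h ⟨w', s, hv⟩
    · rintro ⟨-, w', s, hv, -⟩
      exact h ⟨w⁻¹ * w', s, by rw [map_mul, Module.End.mul_apply, hv, rep_inv_apply]⟩

theorem altProd_rootSigma_comm {v u : S →₀ ℝ} (hvu : v ≠ u) (h0 : M.rootMatrix v u ≠ 0) :
    altProd (rootSigma M v) (rootSigma M u) (M.rootMatrix v u) =
      altProd (rootSigma M u) (rootSigma M v) (M.rootMatrix v u) := by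
  obtain ⟨w, s, t, hst, rfl, rfl⟩ := exists_of_rootEntry_ne_zero hvu h0
  have hm : M.rootMatrix (M.rep w (simpleRoot s)) (M.rep w (simpleRoot t)) = M s t :=
    rootEntry_eq rfl rfl
  rw [hm] at h0 ⊢
  rw [rootSigma_rep, rootSigma_rep, ← MulAut.conj_apply, ← MulAut.conj_apply, ← map_altProd,
    ← map_altProd, altProd_sigma_comm M hst h0]

/-- The homomorphism from the Artin group of the root matrix induced by `rootSigma`. -/
noncomputable def rootSigmaHom : M.rootMatrix.ArtinGroup →* VirtualArtinGroup M :=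
  ArtinGroup.lift _ (rootSigma M) fun _ _ => altProd_rootSigma_comm M

theorem rootSigmaHom_of (v : S →₀ ℝ) : rootSigmaHom M (ArtinGroup.of _ v) = rootSigma M v :=
  ArtinGroup.lift_of _ _ _ v

/-- The homomorphism from the semidirect product, a left inverse of `toRootProduct`. -/
noncomputable def ofRootProduct : RootProduct M →* VirtualArtinGroup M :=
  SemidirectProduct.lift (rootSigmaHom M) (tauHom M) fun w => ArtinGroup.hom_ext fun v => by
    change rootSigmaHom M (M.rootAction w (ArtinGroup.of _ v)) =
      MulAut.conj (tauHom M w) (rootSigmaHom M (ArtinGroup.of _ v))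
    rw [rootAction_of, rootSigmaHom_of, rootSigmaHom_of, rootSigma_conj, MulAut.conj_apply]

theorem ofRootProduct_toRootProduct (g : VirtualArtinGroup M) :
    ofRootProduct M (toRootProduct M g) = g := by
  refine DFunLike.congr_fun (f := (ofRootProduct M).comp (toRootProduct M))
    (g := MonoidHom.id _) (hom_ext (fun s => ?_) fun s => ?_) g
  · rw [MonoidHom.comp_apply, toRootProduct_sigma, ofRootProduct, SemidirectProduct.lift_inl,
      rootSigmaHom_of, MonoidHom.id_apply]
    simpa using rootSigma_rep M 1 s
  · rw [MonoidHom.comp_apply, toRootProduct_tau, ofRootProduct, SemidirectProduct.lift_inr,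
      tauHom_simple, MonoidHom.id_apply]

theorem toRootProduct_injective : Function.Injective (toRootProduct M) :=
  Function.LeftInverse.injective (ofRootProduct_toRootProduct M)

end SemidirectProduct

section Parabolic

variable {M} {S' : Type*} {M' : CoxeterMatrix S'} {j : S' → S}

/-- The homomorphism of virtual Artin groups induced by an inclusion of Coxeter matrices. -/
def map (hj : Function.Injective j) (hM : ∀ x y, M' x y = M (j x) (j y)) :
    VirtualArtinGroup M' →* VirtualArtinGroup M :=
  lift (f := fun x => sigma M (j x)) (g := fun x => tau M (j x))
    (fun x y hxy h0 => by
      rw [hM] at h0 ⊢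
      exact altProd_sigma_comm M (hj.ne hxy) h0)
    (fun x => tau_mul_self M (j x))
    (fun x y hxy h0 => by
      rw [hM] at h0 ⊢
      exact altProd_tau_comm M (hj.ne hxy) h0)
    (fun x y hxy h0 => by
      rw [hM] at h0 ⊢
      rw [sigma_mul_altProd_tau M (hj.ne hxy) h0, apply_ite j])

variable (hj : Function.Injective j) (hM : ∀ x y, M' x y = M (j x) (j y))

theorem map_sigma (x : S') : map hj hM (sigma M' x) = sigma M (j x) := lift_sigma _ _ _ _ x

theorem map_tau (x : S') : map hj hM (tau M' x) = tau M (j x) := lift_tau _ _ _ _ x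

/-- The homomorphism of semidirect products induced by an inclusion of Coxeter matrices. -/
noncomputable def rootProductMap : RootProduct M' →* RootProduct M :=
  SemidirectProduct.map (ArtinGroup.map (rootMap_injective hj) (rootMatrix_rootMap hj hM))
    (groupMap hM) fun w => ArtinGroup.hom_ext fun v => by
      change ArtinGroup.map (rootMap_injective hj) (rootMatrix_rootMap hj hM)
          (M'.rootAction w (ArtinGroup.of _ v)) =
        M.rootAction (groupMap hM w)
          (ArtinGroup.map (rootMap_injective hj) (rootMatrix_rootMap hj hM) (ArtinGroup.of _ v))
      rw [rootAction_of, ArtinGroup.map_of, ArtinGroup.map_of, rootAction_of, rep_groupMap]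

theorem rootProductMap_injective : Function.Injective (rootProductMap hj hM) := by
  intro a b h
  exact SemidirectProduct.ext
    (ArtinGroup.map_injective _ _ (congrArg SemidirectProduct.left h))
    (groupMap_injective hj hM (congrArg SemidirectProduct.right h))

theorem map_injective : Function.Injective (map hj hM) := by
  have h : (rootProductMap hj hM).comp (toRootProduct M') =
      (toRootProduct M).comp (map hj hM) := by
    refine hom_ext (fun x => ?_) fun x => ?_ <;> rw [MonoidHom.comp_apply, MonoidHom.comp_apply]
    · rw [map_sigma, toRootProduct_sigma, toRootProduct_sigma, rootProductMap,
        SemidirectProduct.map_inl, ArtinGroup.map_of, rootMap_simpleRoot]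
    · rw [map_tau, toRootProduct_tau, toRootProduct_tau, rootProductMap,
        SemidirectProduct.map_inr, groupMap_simple]
  refine Function.Injective.of_comp (f := toRootProduct M) ?_
  rw [← MonoidHom.coe_comp, ← h, MonoidHom.coe_comp]
  exact (rootProductMap_injective hj hM).comp (toRootProduct_injective M')

theorem closure_range : Subgroup.closure (Set.range (sigma M) ∪ Set.range (tau M)) = ⊤ := by
  have h : Subgroup.closure (Set.range (PresentedGroup.of (rels := vaRels M))) = ⊤ :=
    PresentedGroup.closure_range_of _
  have e : Sum.elim (sigma M) (tau M) = PresentedGroup.of (rels := vaRels M) := by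
    funext x
    rcases x with x | x <;> rfl
  rw [← Set.Sum.elim_range, e]
  exact h

theorem range_map : (map hj hM).range = parabolic M (Set.range j) := by
  have e1 : map hj hM ∘ sigma M' = (fun s => sigma M s) ∘ j := funext (map_sigma hj hM)
  have e2 : map hj hM ∘ tau M' = (fun s => tau M s) ∘ j := funext (map_tau hj hM)
  rw [MonoidHom.range_eq_map, ← closure_range, MonoidHom.map_closure, parabolic, Set.image_union,
    ← Set.range_comp, ← Set.range_comp, ← Set.range_comp, ← Set.range_comp, e1, e2]

end Parabolic

end VirtualArtinGroup

/-- **Theorem 1.1.** The natural homomorphism `VA[Γ_X] → VA[Γ]` mapping `σ_x ↦ σ_x` and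
`τ_x ↦ τ_x` for `x ∈ X` is injective with image the standard parabolic subgroup `VA_X[Γ]`;
hence it induces an isomorphism `VA[Γ_X] ≅ VA_X[Γ]`. -/
theorem va_parabolic_natural_iso {S : Type*} [Fintype S] [DecidableEq S]
    (M : CoxeterMatrix S) (X : Set S) :
    ∃ φ : VirtualArtinGroup (M.restrict X) →* VirtualArtinGroup M,
      (∀ x : X, φ (VirtualArtinGroup.sigma (M.restrict X) x) = VirtualArtinGroup.sigma M ↑x ∧
        φ (VirtualArtinGroup.tau (M.restrict X) x) = VirtualArtinGroup.tau M ↑x) ∧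
      Function.Injective φ ∧
      φ.range = VirtualArtinGroup.parabolic M X := by
  have hM : ∀ x y, M.restrict X x y = M ↑x ↑y := fun _ _ => rfl
  refine ⟨VirtualArtinGroup.map Subtype.val_injective hM,
    fun x => ⟨VirtualArtinGroup.map_sigma _ _ x, VirtualArtinGroup.map_tau _ _ x⟩,
    VirtualArtinGroup.map_injective _ _, ?_⟩
  rw [VirtualArtinGroup.range_map, Subtype.range_coe]
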